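/- Let p ∈ {2,3,5}, k ∈ {4,6,8,10,14}, d = dim M_k(Γ_0(p)), and ε = ε_{k,p} as in the main theorem. Suppose for each 1 ≤ j ≤ d-1 with p ∤ j, the form (f_{2-k,j}|U_p)(τ) is congruent to the constant a_{2-k}(j,0) mod p^ε, and for each 1 ≤ j ≤ d-1 with p | j, (f_{2-k,j}|U_p)(τ) - f_{2-k,j/p}(τ) is congruent to the constant a_{2-k}(j,0) - a_{2-k}(j/p,0) mod p^ε. Then p^ε | a_k(m p^s, n) for all s > 0 and all m, n > 0 coprime to p. -/

import Mathlib

open UpperHalfPlane Complex CongruenceSubgroup MatrixGroups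
open scoped ModularForm Real MatrixGroups Manifold

noncomputable section

/-- `q = e^{2 π i τ}`. -/
def qexp (τ : UpperHalfPlane) : ℂ := Complex.exp (2 * π * Complex.I * τ)

/-- `f` has the `q`-expansion `∑ c n qⁿ` at `∞`, with only finitely many negative terms. -/
def HasExpansion (f : UpperHalfPlane → ℂ) (c : ℤ → ℂ) : Prop :=
  (∃ N : ℤ, ∀ n : ℤ, n < N → c n = 0) ∧
    ∀ τ : UpperHalfPlane, HasSum (fun n : ℤ => c n * qexp τ ^ n) (f τ)

/-- Weakly holomorphic modular forms of weight `k` on `Γ`, together with their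
Fourier coefficients. -/
structure WhmForm (Γ : Subgroup SL(2, ℤ)) (k : ℤ) where
  toFun : UpperHalfPlane → ℂ
  coeff : ℤ → ℂ
  holo : MDifferentiable 𝓘(ℂ) 𝓘(ℂ) toFun
  slash_eq : ∀ γ ∈ Γ, toFun ∣[k] γ = toFun
  expansion : HasExpansion toFun coeff

/-- `f = q^{-m} + O(q^{ℓ+1})`. -/
def IsBasisElt {Γ : Subgroup SL(2, ℤ)} (k ℓ m : ℤ) (f : WhmForm Γ k) : Prop :=
  f.coeff (-m) = 1 ∧ ∀ n : ℤ, n ≠ -m → n ≤ ℓ → f.coeff n = 0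

/-- multiplication of a point of the upper half plane by a positive real number. -/
def rscale (a : ℝ) (ha : 0 < a) (τ : UpperHalfPlane) : UpperHalfPlane :=
  ⟨a * τ, by simpa [Complex.mul_im] using mul_pos ha τ.2⟩

/-- `τ ↦ -1/τ` on the upper half plane. -/
def neginv (τ : UpperHalfPlane) : UpperHalfPlane :=
  ⟨(-(τ : ℂ))⁻¹, τ.im_inv_neg_coe_pos⟩

/-- `a m n` is the integer Fourier coefficient `a_k(m,n)` of the canonical basis element
`f_{k,m} = q^{-m} + O(q)` (here `ℓ = 0`), with `a m n = 0` out of range. -/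
def IsCoeffs (k : ℤ) (a : ℤ → ℤ → ℤ) : Prop :=
  (∀ m : ℤ, 0 ≤ m → ∃ f : WhmForm ⊤ k, IsBasisElt k 0 m f ∧
      ∀ n : ℤ, 0 < n → f.coeff n = (a m n : ℂ)) ∧
  ∀ m n : ℤ, m < 0 ∨ n ≤ 0 → a m n = 0

/-- The exponent `ε_{k,p}` of the main theorem. -/
def eps (k p : ℕ) : ℕ :=
  if p = 2 then (if k = 8 ∨ k = 10 then 8 else 7)
  else if p = 3 then (if k = 4 ∨ k = 10 then 2 else 3)
  else 1

section

open Filter Topology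

/-! ### Expansions in nonnegative powers of `q` -/

lemma qexp_eq_qParam (τ : ℍ) : qexp τ = Function.Periodic.qParam 1 τ := by
  simp [qexp, Function.Periodic.qParam]

lemma qexp_ne_zero (τ : ℍ) : qexp τ ≠ 0 := Complex.exp_ne_zero _

lemma qexp_rscale (p : ℕ) (hp : 0 < (p : ℝ)) (τ : ℍ) : qexp (rscale p hp τ) = qexp τ ^ p := by
  simp only [qexp, rscale, ← Complex.exp_nat_mul]
  congr 1
  push_cast
  ring

lemma qexp_vadd (τ : ℍ) : qexp ((1 : ℝ) +ᵥ τ) = qexp τ := by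
  simp only [qexp, coe_vadd, ofReal_one, mul_add, mul_one, Complex.exp_add, exp_two_pi_mul_I,
    one_mul]

lemma mdifferentiable_qexp : MDifferentiable 𝓘(ℂ) 𝓘(ℂ) qexp := by
  rw [UpperHalfPlane.mdifferentiable_iff]
  have : DifferentiableOn ℂ (fun z : ℂ ↦ Complex.exp (2 * π * Complex.I * z)) {z | 0 < z.im} := by
    fun_prop
  refine this.congr fun z hz ↦ ?_
  simp [qexp, ofComplex_apply_of_im_pos hz]

lemma tendsto_qexp : Tendsto qexp atImInfty (𝓝 0) := by
  simpa [← qexp_eq_qParam] using qParam_tendsto_atImInfty (h := 1) one_pos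

/-- `F` is the sum of the power series `P` in `q`. -/
def HasPS (F : ℍ → ℂ) (P : PowerSeries ℂ) : Prop :=
  ∀ τ, HasSum (fun n : ℕ ↦ P.coeff n * qexp τ ^ n) (F τ)

/-- The complex power series attached to an integral one. -/
def castPS : PowerSeries ℤ →+* PowerSeries ℂ := PowerSeries.map (Int.castRingHom ℂ)

@[simp] lemma coeff_castPS (P : PowerSeries ℤ) (n : ℕ) :
    (castPS P).coeff n = ((P.coeff n : ℤ) : ℂ) := by
  simp [castPS]

lemma castPS_injective : Function.Injective castPS :=
  PowerSeries.map_injective _ Int.cast_injective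

lemma constantCoeff_castPS (P : PowerSeries ℤ) :
    (castPS P).constantCoeff = ((P.constantCoeff : ℤ) : ℂ) := by
  rw [← PowerSeries.coeff_zero_eq_constantCoeff_apply, coeff_castPS,
    PowerSeries.coeff_zero_eq_constantCoeff_apply]

@[simp] lemma castPS_X : castPS PowerSeries.X = PowerSeries.X := by simp [castPS]

@[simp] lemma castPS_C (c : ℤ) : castPS (PowerSeries.C c) = PowerSeries.C (c : ℂ) := by
  simp [castPS]

namespace HasPS

variable {F G : ℍ → ℂ} {P Q : PowerSeries ℂ}

lemma congr (h : HasPS F P) (hF : ∀ τ, G τ = F τ) : HasPS G P := fun τ ↦ by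
  rw [hF]
  exact h τ

lemma add (hF : HasPS F P) (hG : HasPS G Q) : HasPS (F + G) (P + Q) := fun τ ↦ by
  simpa [add_mul] using (hF τ).add (hG τ)

lemma const_mul (c : ℂ) (hF : HasPS F P) : HasPS (fun τ ↦ c * F τ) (PowerSeries.C c * P) :=
  fun τ ↦ by simpa [mul_assoc] using (hF τ).mul_left c

lemma sub (hF : HasPS F P) (hG : HasPS G Q) : HasPS (F - G) (P - Q) := fun τ ↦ by
  simpa [sub_mul] using (hF τ).sub (hG τ)

lemma mul (hF : HasPS F P) (hG : HasPS G Q) : HasPS (F * G) (P * Q) := fun τ ↦ by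
  have h1 := (hF τ).summable.norm
  have h2 := (hG τ).summable.norm
  have h3 := (summable_norm_sum_mul_antidiagonal_of_summable_norm h1 h2).of_norm
  have h4 := tsum_mul_tsum_eq_tsum_sum_antidiagonal_of_summable_norm h1 h2
  rw [(hF τ).tsum_eq, (hG τ).tsum_eq] at h4
  rw [Pi.mul_apply, h4]
  refine h3.hasSum.congr_fun fun n ↦ ?_
  rw [PowerSeries.coeff_mul, Finset.sum_mul]
  refine Finset.sum_congr rfl fun x hx ↦ ?_
  rw [← Finset.HasAntidiagonal.mem_antidiagonal.mp hx, pow_add]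
  ring

lemma const (c : ℂ) : HasPS (fun _ ↦ c) (PowerSeries.C c) := fun τ ↦ by
  convert hasSum_single 0 ?_ using 1
  · simp
  · intro n hn
    simp [PowerSeries.coeff_C, hn]

lemma one : HasPS 1 1 := by simpa using! HasPS.const 1

lemma pow (hF : HasPS F P) (n : ℕ) : HasPS (F ^ n) (P ^ n) := by
  induction n with
  | zero => simpa using one
  | succ n ih => simpa only [pow_succ] using ih.mul hF

lemma qexp : HasPS qexp PowerSeries.X := fun τ ↦ by
  convert hasSum_single 1 ?_ using 1
  · simp
  · intro n hn
    simp [PowerSeries.coeff_X, hn]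

lemma of_X_pow_mul (N : ℕ) (h : HasPS (_root_.qexp ^ N * F) (PowerSeries.X ^ N * P)) :
    HasPS F P := fun τ ↦ by
  have hq := pow_ne_zero N (qexp_ne_zero τ)
  have h1 := h τ
  rw [← hasSum_nat_add_iff' N] at h1
  rw [Finset.sum_eq_zero, sub_zero] at h1
  · have h2 := h1.mul_left (_root_.qexp τ ^ N)⁻¹
    have h3 : (_root_.qexp τ ^ N)⁻¹ * (_root_.qexp ^ N * F) τ = F τ := by simp [hq]
    rw [h3] at h2
    refine h2.congr_fun fun n ↦ ?_
    · rw [add_comm n N, PowerSeries.coeff_X_pow_mul', if_pos (Nat.le_add_right _ _), pow_add,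
        Nat.add_sub_cancel_left]
      field_simp
  · intro i hi
    rw [PowerSeries.coeff_X_pow_mul', if_neg (by simpa using hi), zero_mul]

lemma rscale (p : ℕ) (hp : p ≠ 0) (hp' : 0 < (p : ℝ)) (hF : HasPS F P) :
    HasPS (fun τ ↦ F (rscale p hp' τ)) (PowerSeries.expand p hp P) := fun τ ↦ by
  have h1 := hF (_root_.rscale p hp' τ)
  have hinj : Function.Injective fun n : ℕ ↦ p * n := fun a b h ↦ Nat.eq_of_mul_eq_mul_left
    (Nat.pos_of_ne_zero hp) h
  rw [← hinj.hasSum_iff]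
  · convert h1 using 2 with n
    simp [qexp_rscale, PowerSeries.coeff_expand_mul, pow_mul]
  · intro n hn
    rw [PowerSeries.coeff_expand_of_not_dvd, zero_mul]
    rintro ⟨c, rfl⟩
    exact hn ⟨c, rfl⟩

lemma hasSum_qParam (hF : HasPS F P) (τ : ℍ) :
    HasSum (fun m ↦ P.coeff m • Function.Periodic.qParam 1 τ ^ m) (F τ) := by
  simpa [← qexp_eq_qParam] using hF τ

lemma isBounded (hF : HasPS F P) : IsBoundedAtImInfty F :=
  isBoundedAtImInfty_of_hasSum_qExpansion one_pos hF.hasSum_qParam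

lemma vadd (hF : HasPS F P) (τ : ℍ) : F ((1 : ℝ) +ᵥ τ) = F τ := by
  have h1 := hF ((1 : ℝ) +ᵥ τ)
  simp only [qexp_vadd] at h1
  exact h1.unique (hF τ)

end HasPS

lemma periodic_of_vadd {F : ℍ → ℂ} (h : ∀ τ : ℍ, F ((1 : ℝ) +ᵥ τ) = F τ) :
    Function.Periodic (F ∘ ofComplex) 1 := by
  intro w
  by_cases! hw : 0 < im w
  · have : 0 < im (w + 1) := by simpa
    simp only [Function.comp_apply, ofComplex_apply_of_im_pos this, ofComplex_apply_of_im_pos hw]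
    rw [← h ⟨w, hw⟩]
    congr 1
    ext
    simp [add_comm]
  · have : im (w + 1) ≤ 0 := by simpa
    simp only [Function.comp_apply, ofComplex_apply_of_im_nonpos this,
      ofComplex_apply_of_im_nonpos hw]

lemma hasPS_of_isBounded {F : ℍ → ℂ} (h : ∀ τ : ℍ, F ((1 : ℝ) +ᵥ τ) = F τ)
    (hF : MDifferentiable 𝓘(ℂ) 𝓘(ℂ) F) (hb : IsBoundedAtImInfty F) :
    HasPS F (qExpansion 1 F) := fun τ ↦ by
  simpa [← qexp_eq_qParam] using
    hasSum_qExpansion one_pos (by simpa using periodic_of_vadd h) hF hb τ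

namespace HasPS

variable {F G : ℍ → ℂ} {P Q : PowerSeries ℂ}

lemma shift (hF : HasPS F P) (hP : P.coeff 0 = 0) :
    HasPS (fun τ ↦ (_root_.qexp τ)⁻¹ * F τ) (PowerSeries.mk fun n ↦ P.coeff (n + 1)) := by
  refine HasPS.of_X_pow_mul 1 ?_
  have h := PowerSeries.eq_X_mul_shift_add_const P
  rw [← PowerSeries.coeff_zero_eq_constantCoeff_apply, hP, map_zero, add_zero] at h
  rw [pow_one, pow_one, ← h]
  exact hF.congr fun τ ↦ by simp [qexp_ne_zero]

lemma tendsto (hF : HasPS F P) : Tendsto F atImInfty (𝓝 (P.coeff 0)) := by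
  have h1 := (hF.sub (HasPS.const (P.coeff 0))).shift (by simp)
  have h2 := (ZeroAtFilter.mul_boundedAtFilter tendsto_qexp h1.isBounded)
  have h4 := Tendsto.add_const (P.coeff 0) h2
  rw [zero_add] at h4
  refine h4.congr fun τ ↦ ?_
  simp [qexp_ne_zero]

lemma eq_zero_of_eq_zero (h : HasPS 0 P) : P = 0 := by
  ext n
  rw [map_zero]
  induction n generalizing P with
  | zero => exact tendsto_nhds_unique h.tendsto tendsto_const_nhds
  | succ n ih =>
    have h0 : P.coeff 0 = 0 := tendsto_nhds_unique h.tendsto tendsto_const_nhds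
    simpa using ih ((h.shift h0).congr fun τ ↦ by simp)

lemma unique (h : HasPS F P) (h' : HasPS F Q) : P = Q := by
  have h1 := h.sub h'
  rw [sub_self] at h1
  exact sub_eq_zero.mp h1.eq_zero_of_eq_zero

end HasPS

/-! ### Forms on `Γ₀(p)` together with their image under the Fricke involution -/

section Pairs

variable (p : ℕ) [Fact p.Prime]

lemma prime_cast_pos : 0 < (p : ℝ) := Nat.cast_pos.mpr (Fact.out : p.Prime).pos

/-- The map `τ ↦ p τ`. -/
def dil (τ : ℍ) : ℍ := rscale p (prime_cast_pos p) τ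

/-- The map `τ ↦ τ / p`. -/
def contr (τ : ℍ) : ℍ := rscale (p : ℝ)⁻¹ (inv_pos.mpr (prime_cast_pos p)) τ

@[simp] lemma coe_dil (τ : ℍ) : (dil p τ : ℂ) = p * τ := by
  simp [dil, rscale]

lemma im_dil (τ : ℍ) : (dil p τ).im = p * τ.im := by
  rw [← coe_im, coe_dil]
  simp [Complex.mul_im]

@[simp] lemma coe_contr (τ : ℍ) : (contr p τ : ℂ) = (p : ℂ)⁻¹ * τ := by
  simp [contr, rscale]

lemma im_contr (τ : ℍ) : (contr p τ).im = (p : ℝ)⁻¹ * τ.im := by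
  rw [← coe_im, coe_contr, ← ofReal_natCast, ← ofReal_inv, Complex.im_ofReal_mul, coe_im]

lemma dil_contr (τ : ℍ) : dil p (contr p τ) = τ := by
  have := (prime_cast_pos p).ne'
  ext
  have : (p : ℂ) ≠ 0 := mod_cast this
  simp [this]

lemma qexp_dil (τ : ℍ) : qexp (dil p τ) = qexp τ ^ p := qexp_rscale p _ τ

lemma mdifferentiable_dil {F : ℍ → ℂ} (hF : MDifferentiable 𝓘(ℂ) 𝓘(ℂ) F) :
    MDifferentiable 𝓘(ℂ) 𝓘(ℂ) fun τ ↦ F (dil p τ) := by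
  rw [UpperHalfPlane.mdifferentiable_iff] at hF ⊢
  have hp := prime_cast_pos p
  have hm : Set.MapsTo (fun z : ℂ ↦ (p : ℂ) * z) {z | 0 < z.im} {z | 0 < z.im} := by
    intro z hz
    simpa [Complex.mul_im] using mul_pos hp hz
  refine (hF.comp (by fun_prop) hm).congr fun z hz ↦ ?_
  simp only [Function.comp_apply, ofComplex_apply_of_im_pos hz,
    ofComplex_apply_of_im_pos (hm hz)]
  congr 1

/-- `F` is a holomorphic function with the weight `k` transformation law under `Γ₀(p)`, and
`G τ = τ⁻ᵏ F (-1 / (p τ))`. -/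
structure PairForm (k : ℤ) (F G : ℍ → ℂ) : Prop where
  holo : MDifferentiable 𝓘(ℂ) 𝓘(ℂ) F
  map_smul : ∀ γ ∈ Gamma0 p, ∀ τ : ℍ, F (γ • τ) = denom γ τ ^ k * F τ
  fricke : ∀ τ : ℍ, F (ModularGroup.S • dil p τ) = (τ : ℂ) ^ k * G τ

variable {p}

namespace PairForm

variable {k l : ℤ} {F G F' G' : ℍ → ℂ}

lemma congr (h : PairForm p k F G) (hkl : k = l) (hF : ∀ τ, F' τ = F τ) (hG : ∀ τ, G' τ = G τ) :
    PairForm p l F' G' := by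
  obtain rfl := hkl
  rwa [funext hF, funext hG]

lemma add (h : PairForm p k F G) (h' : PairForm p k F' G') : PairForm p k (F + F') (G + G') where
  holo := h.holo.add h'.holo
  map_smul γ hγ τ := by
    simp only [Pi.add_apply, h.map_smul γ hγ, h'.map_smul γ hγ, mul_add]
  fricke τ := by simp only [Pi.add_apply, h.fricke, h'.fricke, mul_add]

lemma const_mul (c : ℂ) (h : PairForm p k F G) :
    PairForm p k (fun τ ↦ c * F τ) (fun τ ↦ c * G τ) where
  holo := by simpa using! h.holo.const_smul c
  map_smul γ hγ τ := by simp only [h.map_smul γ hγ]; ring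
  fricke τ := by simp only [h.fricke]; ring

lemma sub (h : PairForm p k F G) (h' : PairForm p k F' G') : PairForm p k (F - F') (G - G') where
  holo := h.holo.sub h'.holo
  map_smul γ hγ τ := by
    simp only [Pi.sub_apply, h.map_smul γ hγ, h'.map_smul γ hγ, mul_sub]
  fricke τ := by simp only [Pi.sub_apply, h.fricke, h'.fricke, mul_sub]

lemma mul (h : PairForm p k F G) (h' : PairForm p l F' G') :
    PairForm p (k + l) (F * F') (G * G') where
  holo := h.holo.mul h'.holo
  map_smul γ hγ τ := by
    simp only [Pi.mul_apply, h.map_smul γ hγ, h'.map_smul γ hγ, zpow_add₀ (denom_ne_zero γ τ)]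
    ring
  fricke τ := by
    simp only [Pi.mul_apply, h.fricke, h'.fricke, zpow_add₀ τ.ne_zero]
    ring

lemma one : PairForm p 0 1 1 where
  holo := mdifferentiable_const
  map_smul γ hγ τ := by simp
  fricke τ := by simp

lemma pow (h : PairForm p k F G) (n : ℕ) : PairForm p (n * k) (F ^ n) (G ^ n) := by
  induction n with
  | zero => simpa using one
  | succ n ih =>
    simp only [pow_succ]
    convert ih.mul h using 1
    push_cast
    ring

lemma div (h : PairForm p k F G) (h' : PairForm p l F' G') (h0 : ∀ τ, F' τ ≠ 0) :
    PairForm p (k - l) (F / F') (G / G') where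
  holo := by
    have h1 := h.holo
    have h2 := h'.holo
    rw [UpperHalfPlane.mdifferentiable_iff] at h1 h2 ⊢
    exact h1.div h2 fun z hz ↦ h0 _
  map_smul γ hγ τ := by
    have := zpow_ne_zero l (denom_ne_zero γ τ)
    simp only [Pi.div_apply, h.map_smul γ hγ, h'.map_smul γ hγ, zpow_sub₀ (denom_ne_zero γ τ)]
    rw [mul_div_mul_comm]
  fricke τ := by
    simp only [Pi.div_apply, h.fricke, h'.fricke, zpow_sub₀ τ.ne_zero]
    rw [mul_div_mul_comm]

end PairForm

lemma exists_dil_smul (γ : SL(2, ℤ)) (hγ : γ ∈ Gamma0 p) :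
    ∃ δ : SL(2, ℤ), ∀ τ : ℍ, dil p (γ • τ) = δ • dil p τ ∧
      denom δ (dil p τ) = denom γ τ ∧ δ 1 0 * p = γ 1 0 := by
  have hp : (p : ℂ) ≠ 0 := mod_cast (prime_cast_pos p).ne'
  rw [Gamma0_mem, ZMod.intCast_zmod_eq_zero_iff_dvd] at hγ
  obtain ⟨c, hc⟩ := hγ
  have hdet := γ.det_coe
  rw [Matrix.det_fin_two, hc] at hdet
  let δ : SL(2, ℤ) := ⟨!![γ 0 0, p * γ 0 1; c, γ 1 1], by
    rw [Matrix.det_fin_two_of]; linarith⟩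
  have hδ : ∀ τ : ℍ, denom δ (dil p τ) = denom γ τ := by
    intro τ
    have e0 : ((γ 1 0 : ℤ) : ℂ) = p * c := by rw [hc]; push_cast; ring
    rw [ModularGroup.denom_apply, ModularGroup.denom_apply, e0, coe_dil]
    simp [δ]
    ring
  refine ⟨δ, fun τ ↦ ⟨?_, hδ τ, by simp [δ, hc, mul_comm]⟩⟩
  ext
  have h1 := hδ τ
  rw [coe_dil, UpperHalfPlane.coe_specialLinearGroup_apply,
    UpperHalfPlane.coe_specialLinearGroup_apply]
  rw [ModularGroup.denom_apply, ModularGroup.denom_apply] at h1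
  simp only [algebraMap_int_eq, eq_intCast, ofReal_intCast] at h1 ⊢
  rw [h1]
  simp [δ]
  ring

lemma S_smul_coe (τ : ℍ) : ((ModularGroup.S • τ : ℍ) : ℂ) = -(τ : ℂ)⁻¹ := by
  rw [modular_S_smul]
  simp [inv_neg]

lemma dil_S_dil (τ : ℍ) : dil p (ModularGroup.S • dil p τ) = ModularGroup.S • τ := by
  have hp : (p : ℂ) ≠ 0 := mod_cast (prime_cast_pos p).ne'
  ext
  rw [coe_dil, S_smul_coe, S_smul_coe, coe_dil]
  have := τ.ne_zero
  field_simp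

lemma denom_S_eq (τ : ℍ) : denom ModularGroup.S τ = τ := ModularGroup.denom_S τ

/-- Level one transformation law. -/
lemma levelOne_smul {k : ℤ} {f : ℍ → ℂ} (hf : ∀ γ : SL(2, ℤ), f ∣[k] γ = f) (γ : SL(2, ℤ))
    (τ : ℍ) : f (γ • τ) = denom γ τ ^ k * f τ := by
  have h := congr_fun (hf γ) τ
  rw [ModularForm.SL_slash_apply] at h
  rw [← h, mul_comm, mul_assoc, ← zpow_add₀ (denom_ne_zero γ τ)]
  simp

lemma pairForm_levelOne {k : ℕ} {f : ℍ → ℂ} (hf : ∀ γ : SL(2, ℤ), f ∣[(k : ℤ)] γ = f)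
    (hm : MDifferentiable 𝓘(ℂ) 𝓘(ℂ) f) : PairForm p k f (fun τ ↦ (p : ℂ) ^ k * f (dil p τ)) where
  holo := hm
  map_smul γ _ τ := levelOne_smul hf γ τ
  fricke τ := by
    rw [levelOne_smul hf, denom_S_eq, coe_dil, mul_zpow]
    simp
    ring

lemma pairForm_levelOne_dil {k : ℤ} {f : ℍ → ℂ} (hf : ∀ γ : SL(2, ℤ), f ∣[k] γ = f)
    (hm : MDifferentiable 𝓘(ℂ) 𝓘(ℂ) f) : PairForm p k (fun τ ↦ f (dil p τ)) f where
  holo := mdifferentiable_dil p hm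
  map_smul γ hγ τ := by
    obtain ⟨δ, hδ⟩ := exists_dil_smul γ hγ
    rw [(hδ τ).1, levelOne_smul hf, (hδ τ).2.1]
  fricke τ := by rw [dil_S_dil, levelOne_smul hf, denom_S_eq]

lemma exists_coset (γ : SL(2, ℤ)) :
    γ ∈ Gamma0 p ∨ ∃ δ ∈ Gamma0 p, ∃ j : ℤ, γ = δ * (ModularGroup.S * ModularGroup.T ^ j) := by
  by_cases h : (γ 1 0 : ZMod p) = 0
  · exact .inl (Gamma0_mem.mpr h)
  right
  obtain ⟨j, hj⟩ := ZMod.intCast_surjective (((γ 1 1 : ℤ) : ZMod p) / ((γ 1 0 : ℤ) : ZMod p))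
  refine ⟨γ * (ModularGroup.S * ModularGroup.T ^ j)⁻¹, ?_, j, by group⟩
  rw [Gamma0_mem, mul_inv_rev, ← mul_assoc, ← zpow_neg]
  have : ((γ * ModularGroup.T ^ (-j) * ModularGroup.S⁻¹ : SL(2, ℤ)) 1 0 : ℤ)
      = γ 1 0 * j - γ 1 1 := by
    rw [Matrix.SpecialLinearGroup.coe_mul, Matrix.SpecialLinearGroup.coe_mul,
      ModularGroup.coe_T_zpow, Matrix.SpecialLinearGroup.coe_inv, ModularGroup.coe_S]
    simp [Matrix.mul_apply, Fin.sum_univ_two, Matrix.adjugate_fin_two]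
    ring
  rw [this]
  push_cast
  rw [hj]
  field_simp
  simp

lemma T_zpow_smul_im (j : ℤ) (τ : ℍ) : (ModularGroup.T ^ j • τ : ℍ).im = τ.im := by
  rw [UpperHalfPlane.modular_T_zpow_smul]
  simp

namespace PairForm

variable {k : ℤ} {F G : ℍ → ℂ}

lemma slash_eq (h : PairForm p k F G) (γ : SL(2, ℤ)) (hγ : γ ∈ Gamma0 p) : F ∣[k] γ = F := by
  ext τ
  rw [ModularForm.SL_slash_apply, h.map_smul γ hγ, mul_comm, ← mul_assoc,
    ← zpow_add₀ (denom_ne_zero γ τ)]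
  simp

lemma slash_S (h : PairForm p k F G) (τ : ℍ) :
    (F ∣[k] ModularGroup.S) τ = (p : ℂ) ^ (-k) * G (contr p τ) := by
  have hf := h.fricke (contr p τ)
  rw [dil_contr, coe_contr] at hf
  rw [ModularForm.SL_slash_apply, hf, denom_S_eq, mul_zpow, inv_zpow, zpow_neg, zpow_neg]
  have := zpow_ne_zero k τ.ne_zero
  field_simp

lemma isBounded_slash (h : PairForm p k F G) (hF : IsBoundedAtImInfty F)
    (hG : IsBoundedAtImInfty G) (γ : SL(2, ℤ)) : IsBoundedAtImInfty (F ∣[k] γ) := by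
  rcases exists_coset (p := p) γ with hγ | ⟨δ, hδ, j, rfl⟩
  · rwa [h.slash_eq γ hγ]
  · rw [SlashAction.slash_mul, h.slash_eq δ hδ, SlashAction.slash_mul]
    rw [isBoundedAtImInfty_iff] at hG ⊢
    obtain ⟨M, A, hM⟩ := hG
    refine ⟨‖(p : ℂ) ^ (-k)‖ * M, p * A, fun τ hτ ↦ ?_⟩
    have hT : denom (ModularGroup.T ^ j : SL(2, ℤ)) τ = 1 := by
      rw [ModularGroup.denom_apply, ModularGroup.coe_T_zpow]
      simp
    rw [ModularForm.SL_slash_apply, h.slash_S, hT, one_zpow, mul_one, norm_mul]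
    refine mul_le_mul_of_nonneg_left (hM _ ?_) (norm_nonneg _)
    rw [im_contr, T_zpow_smul_im]
    have hp := prime_cast_pos p
    rw [inv_mul_eq_div, le_div_iff₀ hp]
    linarith

/-- The modular form attached to a pair bounded at both cusps. -/
def toModularForm (h : PairForm p k F G) (hF : IsBoundedAtImInfty F)
    (hG : IsBoundedAtImInfty G) : ModularForm (Gamma0 p) k where
  toFun := F
  slash_action_eq' γ hγ := by
    obtain ⟨δ, hδ, rfl⟩ := hγ
    exact h.slash_eq δ hδ
  holo' := h.holo
  bdd_at_cusps' {c} hc := by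
    have hc' : IsCusp c 𝒮ℒ := hc.mono (by
      rintro _ ⟨δ, hδ, rfl⟩
      exact ⟨δ, rfl⟩)
    exact (OnePoint.isBoundedAt_iff_forall_SL2Z hc').mpr fun γ _ ↦ h.isBounded_slash hF hG γ

lemma const_of_weight_zero (h : PairForm p 0 F G) (hF : IsBoundedAtImInfty F)
    (hG : IsBoundedAtImInfty G) : ∃ c, ∀ τ, F τ = c := by
  have : NeZero p := ⟨(Fact.out : p.Prime).ne_zero⟩
  obtain ⟨c, hc⟩ := ModularForm.eq_const_of_weight_zero (h.toModularForm hF hG)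
  exact ⟨c, fun τ ↦ congr_fun hc τ⟩

end PairForm

lemma ModularForm.exists_pairForm {k : ℤ} (f : ModularForm (Gamma0 p) k) :
    ∃ G, PairForm p k f G ∧ IsBoundedAtImInfty f ∧ IsBoundedAtImInfty G := by
  have : NeZero p := ⟨(Fact.out : p.Prime).ne_zero⟩
  have hsl : ∀ γ ∈ Gamma0 p, (f : ℍ → ℂ) ∣[k] γ = f := fun γ hγ ↦
    f.slash_action_eq' _ ⟨γ, hγ, rfl⟩
  have hb : ∀ γ : SL(2, ℤ), IsBoundedAtImInfty ((f : ℍ → ℂ) ∣[k] γ) := fun γ ↦ by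
    exact ModularFormClass.bdd_at_infty_slash f γ
  refine ⟨fun τ ↦ (τ : ℂ) ^ (-k) * f (ModularGroup.S • dil p τ), ⟨f.holo', fun γ hγ τ ↦ ?_,
    fun τ ↦ ?_⟩, ?_, ?_⟩
  · have h := congr_fun (hsl γ hγ) τ
    rw [ModularForm.SL_slash_apply] at h
    rw [← h, mul_comm, mul_assoc, ← zpow_add₀ (denom_ne_zero γ τ)]
    simp
  · rw [← mul_assoc, ← zpow_add₀ τ.ne_zero]
    simp
  · simpa using hb 1
  · have h := hb ModularGroup.S
    rw [isBoundedAtImInfty_iff] at h ⊢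
    obtain ⟨M, A, hM⟩ := h
    refine ⟨‖(p : ℂ) ^ k‖ * M, A / p, fun τ hτ ↦ ?_⟩
    have hp := prime_cast_pos p
    have h1 := hM (dil p τ) (by
      rw [im_dil]
      rw [div_le_iff₀ hp] at hτ
      linarith)
    have h2 : (τ : ℂ) ^ (-k) * f (ModularGroup.S • dil p τ) =
        (p : ℂ) ^ k * ((f : ℍ → ℂ) ∣[k] ModularGroup.S) (dil p τ) := by
      rw [ModularForm.SL_slash_apply, denom_S_eq, coe_dil, mul_zpow, zpow_neg, zpow_neg]
      have := zpow_ne_zero k τ.ne_zero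
      have : (p : ℂ) ^ k ≠ 0 := zpow_ne_zero k (mod_cast hp.ne')
      field_simp
    rw [h2, norm_mul]
    exact mul_le_mul_of_nonneg_left h1 (norm_nonneg _)

end Pairs

/-! ### Level one forms and the weight two Eisenstein series of level `p` -/

namespace HasPS

variable {F G : ℍ → ℂ} {P Q : PowerSeries ℤ}

lemma cast_add (hF : HasPS F (castPS P)) (hG : HasPS G (castPS Q)) :
    HasPS (F + G) (castPS (P + Q)) := by
  rw [map_add]
  exact hF.add hG

lemma cast_sub (hF : HasPS F (castPS P)) (hG : HasPS G (castPS Q)) :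
    HasPS (F - G) (castPS (P - Q)) := by
  rw [map_sub]
  exact hF.sub hG

lemma cast_mul (hF : HasPS F (castPS P)) (hG : HasPS G (castPS Q)) :
    HasPS (F * G) (castPS (P * Q)) := by
  rw [map_mul]
  exact hF.mul hG

lemma cast_pow (hF : HasPS F (castPS P)) (n : ℕ) : HasPS (F ^ n) (castPS (P ^ n)) := by
  rw [map_pow]
  exact hF.pow n

lemma cast_const_mul (c : ℤ) (hF : HasPS F (castPS P)) :
    HasPS (fun τ ↦ (c : ℂ) * F τ) (castPS (PowerSeries.C c * P)) := by
  rw [map_mul, castPS_C]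
  exact hF.const_mul c

end HasPS

/-- The generating series of the divisor power sum `σ_k`. -/
def sigmaSeries (k : ℕ) : PowerSeries ℤ := .mk fun n ↦ (ArithmeticFunction.sigma k n : ℤ)

lemma coeff_sigmaSeries (k n : ℕ) :
    (sigmaSeries k).coeff n = (ArithmeticFunction.sigma k n : ℤ) := PowerSeries.coeff_mk _ _

lemma constantCoeff_sigmaSeries (k : ℕ) : (sigmaSeries k).constantCoeff = 0 := by
  rw [← PowerSeries.coeff_zero_eq_constantCoeff_apply, coeff_sigmaSeries]
  simp

lemma coeff_one_sigmaSeries (k : ℕ) : (sigmaSeries k).coeff 1 = 1 := by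
  simp [coeff_sigmaSeries]

lemma levelOne_slash {k : ℤ} (f : ModularForm 𝒮ℒ k) (γ : SL(2, ℤ)) : (f : ℍ → ℂ) ∣[k] γ = f :=
  f.slash_action_eq' _ ⟨γ, rfl⟩

lemma levelOne_vadd {k : ℤ} {f : ℍ → ℂ} (hf : ∀ γ : SL(2, ℤ), f ∣[k] γ = f) (τ : ℍ) :
    f ((1 : ℝ) +ᵥ τ) = f τ := by
  have h := levelOne_smul hf ModularGroup.T τ
  rw [modular_T_smul] at h
  rw [h, ModularGroup.denom_apply]
  simp [ModularGroup.T]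

lemma isBoundedAtImInfty_levelOne {k : ℤ} (f : ModularForm 𝒮ℒ k) :
    IsBoundedAtImInfty (f : ℍ → ℂ) := ModularFormClass.bdd_at_infty f

lemma hasPS_levelOne {k : ℤ} (f : ModularForm 𝒮ℒ k) : HasPS f (qExpansion 1 f) :=
  hasPS_of_isBounded (levelOne_vadd (levelOne_slash f)) f.holo' (isBoundedAtImInfty_levelOne f)

lemma hasPS_E₄ : HasPS ModularForm.E₄ (castPS (1 + 240 * sigmaSeries 3)) := by
  have h := hasPS_levelOne ModularForm.E₄
  convert h using 1
  ext n
  rw [coeff_castPS, EisensteinSeries.E_qExpansion_coeff _ ⟨2, rfl⟩,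
    show (240 : PowerSeries ℤ) = PowerSeries.C 240 by simp, map_add, PowerSeries.coeff_C_mul,
    coeff_sigmaSeries, PowerSeries.coeff_one, show bernoulli 4 = -1 / 30 by decide +kernel]
  rcases eq_or_ne n 0 with rfl | hn
  · simp
  · simp [hn]
    norm_num

lemma hasPS_E₆ : HasPS ModularForm.E₆ (castPS (1 - 504 * sigmaSeries 5)) := by
  have h := hasPS_levelOne ModularForm.E₆
  convert h using 1
  ext n
  rw [coeff_castPS, EisensteinSeries.E_qExpansion_coeff _ ⟨3, rfl⟩,
    show (504 : PowerSeries ℤ) = PowerSeries.C 504 by simp, map_sub, PowerSeries.coeff_C_mul,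
    coeff_sigmaSeries, PowerSeries.coeff_one, show bernoulli 6 = 1 / 42 by decide +kernel]
  rcases eq_or_ne n 0 with rfl | hn
  · simp
  · simp [hn]
    norm_num

lemma dvd_sigma_combination (n : ℕ) :
    (12 : ℤ) ∣ 5 * (ArithmeticFunction.sigma 3 n : ℤ) + 7 * (ArithmeticFunction.sigma 5 n : ℤ) := by
  rw [ArithmeticFunction.sigma_apply, ArithmeticFunction.sigma_apply]
  push_cast
  rw [Finset.mul_sum, Finset.mul_sum, ← Finset.sum_add_distrib]
  refine Finset.dvd_sum fun d _ ↦ ?_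
  refine (ZMod.intCast_zmod_eq_zero_iff_dvd _ 12).mp ?_
  push_cast
  generalize (d : ZMod 12) = x
  revert x
  decide

/-- The power series `D` with `Δ = q D`. -/
def deltaSeries : PowerSeries ℤ :=
  .mk fun n ↦ (.mk (fun n ↦ (5 * (ArithmeticFunction.sigma 3 n : ℤ) +
    7 * (ArithmeticFunction.sigma 5 n : ℤ)) / 12) + 100 * sigmaSeries 3 ^ 2 +
    8000 * sigmaSeries 3 ^ 3 - 147 * sigmaSeries 5 ^ 2 : PowerSeries ℤ).coeff (n + 1)

lemma X_mul_deltaSeries : 1728 * (PowerSeries.X * deltaSeries) =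
    (1 + 240 * sigmaSeries 3) ^ 3 - (1 - 504 * sigmaSeries 5) ^ 2 := by
  set C : PowerSeries ℤ := .mk (fun n ↦ (5 * (ArithmeticFunction.sigma 3 n : ℤ) +
    7 * (ArithmeticFunction.sigma 5 n : ℤ)) / 12) with hC
  have h12 : 12 * C = 5 * sigmaSeries 3 + 7 * sigmaSeries 5 := by
    rw [show (12 : PowerSeries ℤ) = PowerSeries.C 12 by simp,
      show (5 : PowerSeries ℤ) = PowerSeries.C 5 by simp,
      show (7 : PowerSeries ℤ) = PowerSeries.C 7 by simp]
    ext n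
    rw [map_add, PowerSeries.coeff_C_mul, PowerSeries.coeff_C_mul, PowerSeries.coeff_C_mul,
      coeff_sigmaSeries, coeff_sigmaSeries, PowerSeries.coeff_mk,
      Int.mul_ediv_cancel' (dvd_sigma_combination n)]
  have h0 : (C + 100 * sigmaSeries 3 ^ 2 + 8000 * sigmaSeries 3 ^ 3 -
      147 * sigmaSeries 5 ^ 2).constantCoeff = 0 := by
    have hC0 : C.constantCoeff = 0 := by
      rw [← PowerSeries.coeff_zero_eq_constantCoeff_apply, hC, PowerSeries.coeff_mk]
      simp
    simp [hC0, constantCoeff_sigmaSeries]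
  have hX : PowerSeries.X * deltaSeries = C + 100 * sigmaSeries 3 ^ 2 + 8000 * sigmaSeries 3 ^ 3 -
      147 * sigmaSeries 5 ^ 2 := by
    rw [PowerSeries.eq_X_mul_shift_add_const (C + 100 * sigmaSeries 3 ^ 2 +
      8000 * sigmaSeries 3 ^ 3 - 147 * sigmaSeries 5 ^ 2), h0]
    simp [deltaSeries, hC]
  rw [hX]
  linear_combination 144 * h12

lemma hasPS_discriminant :
    HasPS ModularForm.discriminant (castPS (PowerSeries.X * deltaSeries)) := by
  have h := ((hasPS_E₄.pow 3).sub (hasPS_E₆.pow 2)).const_mul (1728 : ℂ)⁻¹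
  rw [← map_pow, ← map_pow, ← map_sub, ← X_mul_deltaSeries, map_mul, ← mul_assoc] at h
  convert h using 1
  · ext τ
    rw [ModularForm.discriminant_eq_E₄_cube_sub_E₆_sq]
    simp only [Pi.sub_apply, Pi.pow_apply]
    ring
  · rw [show (1728 : PowerSeries ℤ) = PowerSeries.C 1728 by simp, castPS_C, ← map_mul]
    simp

lemma constantCoeff_deltaSeries : deltaSeries.constantCoeff = 1 := by
  rw [← PowerSeries.coeff_zero_eq_constantCoeff_apply, deltaSeries, PowerSeries.coeff_mk]
  simp [pow_succ, PowerSeries.coeff_mul, Finset.Nat.antidiagonal_succ, constantCoeff_sigmaSeries]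

/-- The reciprocal of `deltaSeries`. -/
def deltaInvSeries : PowerSeries ℤ := deltaSeries.invOfUnit 1

lemma deltaSeries_mul_inv : deltaSeries * deltaInvSeries = 1 :=
  PowerSeries.mul_invOfUnit _ _ constantCoeff_deltaSeries

lemma constantCoeff_deltaInvSeries : deltaInvSeries.constantCoeff = 1 := by
  have h := congrArg PowerSeries.constantCoeff deltaSeries_mul_inv
  simpa [constantCoeff_deltaSeries] using h

lemma discriminant_slash (γ : SL(2, ℤ)) :
    ModularForm.discriminant ∣[(12 : ℤ)] γ = ModularForm.discriminant :=
  CuspForm.discriminant.slash_action_eq' _ ⟨γ, rfl⟩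

lemma discriminant_holo : MDifferentiable 𝓘(ℂ) 𝓘(ℂ) ModularForm.discriminant :=
  CuspForm.discriminant.holo'

/-- `q / Δ` has the `q`-expansion `deltaInvSeries`. -/
lemma hasPS_qexp_div_discriminant :
    HasPS (fun τ ↦ qexp τ / ModularForm.discriminant τ) (castPS deltaInvSeries) := by
  have hD : HasPS (fun τ ↦ (qexp τ)⁻¹ * ModularForm.discriminant τ) (castPS deltaSeries) := by
    refine .of_X_pow_mul 1 (hasPS_discriminant.congr (fun τ ↦ ?_) |> fun h ↦ by
      simpa using h)
    simp [qexp_ne_zero]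
  have hb : IsBoundedAtImInfty (fun τ ↦ qexp τ / ModularForm.discriminant τ) := by
    have h := hD.tendsto.inv₀ (by simp [constantCoeff_deltaSeries])
    refine (h.congr fun τ ↦ ?_).isBigO_one ℝ
    simp [div_eq_mul_inv, mul_comm]
  have h := hasPS_of_isBounded (F := fun τ ↦ qexp τ / ModularForm.discriminant τ) (fun τ ↦ by
    rw [qexp_vadd, levelOne_vadd discriminant_slash])
    (by
      have h1 := mdifferentiable_qexp
      have h2 := discriminant_holo
      rw [UpperHalfPlane.mdifferentiable_iff] at h1 h2 ⊢
      exact h1.div h2 fun z hz ↦ ModularForm.discriminant_ne_zero _) hb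
  convert h using 1
  have h1 := (h.mul hD).unique (HasPS.one.congr fun τ ↦ by
    have := qexp_ne_zero τ
    have := ModularForm.discriminant_ne_zero τ
    simp only [Pi.mul_apply, Pi.one_apply]
    field_simp)
  have h2 : castPS deltaSeries * castPS deltaInvSeries = 1 := by
    rw [← map_mul, deltaSeries_mul_inv, map_one]
  rw [← mul_one (qExpansion 1 _), ← h2, ← mul_assoc, h1, one_mul]

lemma E2_smul : ∃ c : ℂ, ∀ (γ : SL(2, ℤ)) (τ : ℍ),
    EisensteinSeries.E2 (γ • τ) =
      denom γ τ ^ 2 * (EisensteinSeries.E2 τ - c * (γ 1 0 : ℤ) / denom γ τ) := by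
  refine ⟨1 / (2 * riemannZeta 2) * (2 * π * Complex.I), fun γ τ ↦ ?_⟩
  have h := congr_fun (EisensteinSeries.E2_slash_action γ) τ
  rw [ModularForm.SL_slash_apply] at h
  have h0 := denom_ne_zero γ τ
  simp only [Pi.sub_apply, Pi.smul_apply, EisensteinSeries.D2, smul_eq_mul] at h
  rw [show EisensteinSeries.E2 (γ • τ) =
    denom γ τ ^ 2 * (EisensteinSeries.E2 (γ • τ) * denom γ τ ^ (-2 : ℤ)) by
      rw [zpow_neg, zpow_ofNat]; field_simp, h]
  ring

section Theta

variable (p : ℕ) [Fact p.Prime]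

/-- `p E₂(pτ) - E₂(τ)`, a form of weight two on `Γ₀(p)`. -/
def thetaForm (τ : ℍ) : ℂ := p * EisensteinSeries.E2 (dil p τ) - EisensteinSeries.E2 τ

lemma pairForm_thetaForm : PairForm p 2 (thetaForm p) (fun τ ↦ -p * thetaForm p τ) := by
  obtain ⟨c, hc⟩ := E2_smul
  have hp : (p : ℂ) ≠ 0 := mod_cast (prime_cast_pos p).ne'
  refine ⟨?_, fun γ hγ τ ↦ ?_, fun τ ↦ ?_⟩
  · exact ((mdifferentiable_dil p E2_mdifferentiable).const_smul (p : ℂ)).sub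
      E2_mdifferentiable
  · obtain ⟨δ, hδ⟩ := exists_dil_smul γ hγ
    obtain ⟨e1, e2, e3⟩ := hδ τ
    have h0 := denom_ne_zero γ τ
    simp only [thetaForm]
    rw [e1, hc, hc, e2, ← e3, zpow_ofNat]
    push_cast
    ring
  · have h0 := τ.ne_zero
    simp only [thetaForm]
    rw [dil_S_dil, hc, hc, denom_S_eq, denom_S_eq, coe_dil, zpow_ofNat]
    simp only [ModularGroup.coe_S]
    simp
    field_simp
    ring

/-- The coefficient series `∑ (σ₁(n) - p σ₁(n/p)) qⁿ`. -/
def thetaSeries : PowerSeries ℤ :=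
  sigmaSeries 1 - PowerSeries.C (p : ℤ) *
    PowerSeries.expand p (Fact.out : p.Prime).ne_zero (sigmaSeries 1)

lemma hasPS_E2 : HasPS EisensteinSeries.E2 (castPS (1 - 24 * sigmaSeries 1)) := fun τ ↦ by
  refine (EisensteinSeries.hasSum_qExpansion_E2 (z := τ)).congr_fun fun n ↦ ?_
  rw [coeff_castPS, show (24 : PowerSeries ℤ) = PowerSeries.C 24 by simp, map_sub,
    PowerSeries.coeff_C_mul, coeff_sigmaSeries, PowerSeries.coeff_one, qexp_eq_qParam]
  rcases eq_or_ne n 0 with rfl | hn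
  · simp
  · simp [hn, Function.Periodic.qParam]

lemma HasPS.dil {F : ℍ → ℂ} {P : PowerSeries ℤ} (h : HasPS F (castPS P)) :
    HasPS (fun τ ↦ F (dil p τ))
      (castPS (PowerSeries.expand p (Fact.out : p.Prime).ne_zero P)) := by
  rw [castPS, PowerSeries.map_expand]
  exact h.rscale p _ _

lemma hasPS_thetaForm :
    HasPS (thetaForm p) (castPS (PowerSeries.C ((p : ℤ) - 1) + 24 * thetaSeries p)) := by
  have h := ((hasPS_E2.dil p).const_mul (p : ℂ)).sub hasPS_E2
  rw [show PowerSeries.C (p : ℂ) = castPS (PowerSeries.C (p : ℤ)) by simp, ← map_mul,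
    ← map_sub] at h
  convert h using 1
  · rfl
  · simp only [thetaSeries, map_add, map_sub, map_mul, map_one, map_ofNat]
    ring

end Theta

/-! ### A Hauptmodul on `Γ₀(p)` with integral expansions -/

lemma PowerSeries.exists_eq_C_mul_of_pow {j N : ℕ} (hj : j ≠ 0) (hN : N ≠ 0) :
    ∀ R Q : PowerSeries ℤ, R ^ j = PowerSeries.C (N : ℤ) ^ j * Q →
      ∃ S, R = PowerSeries.C (N : ℤ) * S := by
  induction N using Nat.recOnMul with
  | zero => exact absurd rfl hN
  | one => exact fun R Q _ ↦ ⟨R, by simp⟩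
  | prime l hl =>
    intro R Q h
    have : Fact l.Prime := ⟨hl⟩
    have h1 : (PowerSeries.map (Int.castRingHom (ZMod l)) R) ^ j = 0 := by
      rw [← map_pow, h, map_mul, map_pow, PowerSeries.map_C]
      simp [hj]
    have h2 := pow_eq_zero_iff hj |>.mp h1
    choose S hS using fun n ↦ (ZMod.intCast_zmod_eq_zero_iff_dvd (R.coeff n) l).mp (by
      simpa using congrArg (PowerSeries.coeff n) h2)
    exact ⟨.mk S, by ext n; rw [PowerSeries.coeff_C_mul, PowerSeries.coeff_mk, hS]⟩
  | mul a b iha ihb =>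
    intro R Q h
    have ha : a ≠ 0 := left_ne_zero_of_mul hN
    have hb : b ≠ 0 := right_ne_zero_of_mul hN
    rw [Nat.cast_mul, map_mul, mul_pow, mul_assoc] at h
    obtain ⟨S, rfl⟩ := iha ha R _ h
    rw [mul_pow] at h
    have hC : PowerSeries.C (a : ℤ) ≠ 0 :=
      (map_ne_zero_iff _ PowerSeries.C_injective).mpr (mod_cast ha)
    obtain ⟨T, rfl⟩ := ihb hb S _ (mul_left_cancel₀ (pow_ne_zero j hC) h)
    exact ⟨T, by rw [Nat.cast_mul, map_mul, mul_assoc]⟩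

section Hauptmodul

variable (p : ℕ) [hpf : Fact p.Prime]

lemma pairForm_discriminant : PairForm p 12 ModularForm.discriminant
    (fun τ ↦ (p : ℂ) ^ 12 * ModularForm.discriminant (dil p τ)) :=
  pairForm_levelOne (k := 12) discriminant_slash discriminant_holo

lemma pairForm_discriminant_dil : PairForm p 12 (fun τ ↦ ModularForm.discriminant (dil p τ))
    ModularForm.discriminant :=
  pairForm_levelOne_dil discriminant_slash discriminant_holo

/-- Substitution of `q ^ p` for `q`. -/
abbrev exq (P : PowerSeries ℤ) : PowerSeries ℤ := PowerSeries.expand p hpf.out.ne_zero P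

lemma exq_X : exq p .X = .X ^ p := by simp [exq]

lemma hasPS_discriminant_dil : HasPS (fun τ ↦ ModularForm.discriminant (dil p τ))
    (castPS (.X ^ p * exq p deltaSeries)) := by
  have h := hasPS_discriminant.dil p
  rwa [map_mul, show PowerSeries.expand p _ PowerSeries.X = _ from exq_X p] at h

lemma hasPS_qexp_div_discriminant_dil :
    HasPS (fun τ ↦ qexp τ ^ p / ModularForm.discriminant (dil p τ))
      (castPS (exq p deltaInvSeries)) :=
  (hasPS_qexp_div_discriminant.dil p).congr fun τ ↦ by rw [qexp_dil]

lemma exq_delta_mul_inv : exq p deltaSeries * exq p deltaInvSeries = 1 := by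
  rw [← map_mul, deltaSeries_mul_inv, map_one]

lemma constantCoeff_exq (P : PowerSeries ℤ) : (exq p P).constantCoeff = P.constantCoeff := by
  simp [exq]

end Hauptmodul

section

variable {p : ℕ} [hpf : Fact p.Prime]

/-- The product expansions of a form vanishing only at `∞`, to order two there, and of its
Fricke conjugate. -/
lemma pow_eq_of_pairForm {w : ℤ} {j N : ℕ} (hj : (j : ℤ) * w = 12 * (p - 1))
    (hjp : 2 * j + 1 = p ^ 2) {R RW : ℍ → ℂ} (hR : PairForm p w R RW) {P Q : PowerSeries ℤ}
    (hP : HasPS R (castPS (.X ^ 2 * P))) (hQ : HasPS RW (castPS Q)) (h0 : P.constantCoeff = N) :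
    P ^ j = PowerSeries.C (N : ℤ) ^ j * (deltaInvSeries * exq p deltaSeries ^ p) ∧
    PowerSeries.C (p : ℤ) ^ 12 * Q ^ j =
      PowerSeries.C (N : ℤ) ^ j * (deltaSeries ^ p * exq p deltaInvSeries) := by
  have hD := ModularForm.discriminant_ne_zero
  have hg := (((hR.pow j).mul (pairForm_discriminant p)).div ((pairForm_discriminant_dil p).pow p)
    fun τ ↦ pow_ne_zero p (hD _)).congr (l := 0) (by rw [hj]; ring) (fun _ ↦ rfl) (fun _ ↦ rfl)
  set g := R ^ j * ModularForm.discriminant /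
    (fun τ ↦ ModularForm.discriminant (dil p τ)) ^ p with hgdef
  set G := RW ^ j * (fun τ ↦ (p : ℂ) ^ 12 * ModularForm.discriminant (dil p τ)) /
    ModularForm.discriminant ^ p with hGdef
  have hgP : HasPS g (castPS (P ^ j * deltaSeries * exq p deltaInvSeries ^ p)) := by
    refine .of_X_pow_mul (p ^ 2) ?_
    have h := ((hP.pow j).mul hasPS_discriminant).mul ((hasPS_qexp_div_discriminant_dil p).pow p)
    rw [← map_pow, ← map_mul, ← map_pow, ← map_mul] at h
    rw [← castPS_X, ← map_pow, ← map_mul]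
    convert h using 1
    · ext τ
      simp only [hgdef, Pi.mul_apply, Pi.pow_apply, Pi.div_apply, div_pow, ← pow_mul, sq]
      ring
    · rw [← hjp]
      congr 1
      ring
  have hGP : HasPS G (castPS (PowerSeries.C (p : ℤ) ^ 12 * Q ^ j * exq p deltaSeries *
      deltaInvSeries ^ p)) := by
    refine .of_X_pow_mul p ?_
    have h := ((hQ.pow j).mul ((hasPS_discriminant_dil p).const_mul ((p : ℂ) ^ 12))).mul
      (hasPS_qexp_div_discriminant.pow p)
    rw [show PowerSeries.C ((p : ℂ) ^ 12) = castPS (PowerSeries.C (p : ℤ) ^ 12) by simp,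
      ← map_pow castPS, ← map_mul, ← map_mul, ← map_pow castPS,
      ← map_mul] at h
    rw [← castPS_X, ← map_pow, ← map_mul]
    convert h using 1
    · ext τ
      simp only [hGdef, Pi.mul_apply, Pi.pow_apply, Pi.div_apply, div_pow]
      ring
    · congr 1
      ring
  obtain ⟨c, hc⟩ := hg.const_of_weight_zero hgP.isBounded hGP.isBounded
  have h1 := (hgP.congr fun τ ↦ (hc τ).symm).unique (HasPS.const c)
  have hcN : c = (N : ℂ) ^ j := by
    have h2 := congrArg PowerSeries.constantCoeff h1
    rw [constantCoeff_castPS] at h2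
    simpa [constantCoeff_exq, h0, constantCoeff_deltaSeries, constantCoeff_deltaInvSeries,
      eq_comm] using h2
  have hC : PowerSeries.C c = castPS (PowerSeries.C (N : ℤ) ^ j) := by simp [hcN]
  have hGc : ∀ τ, G τ = c := fun τ ↦ by
    have h := hg.fricke τ
    rw [hc, zpow_zero, one_mul] at h
    exact h.symm
  have h2 := (hGP.congr fun τ ↦ (hGc τ).symm).unique (HasPS.const c)
  rw [hC] at h1 h2
  have e1 := castPS_injective h1
  have e2 := castPS_injective h2
  have d1 := deltaSeries_mul_inv
  have d2 := exq_delta_mul_inv p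
  have d1p : deltaSeries ^ p * deltaInvSeries ^ p = 1 := by rw [← mul_pow, d1, one_pow]
  have d2p : exq p deltaSeries ^ p * exq p deltaInvSeries ^ p = 1 := by
    rw [← mul_pow, d2, one_pow]
  constructor
  · calc P ^ j = (P ^ j * deltaSeries * exq p deltaInvSeries ^ p) *
        (deltaInvSeries * exq p deltaSeries ^ p) := by
          linear_combination (-P ^ j * (exq p deltaSeries ^ p * exq p deltaInvSeries ^ p)) * d1
            - P ^ j * d2p
      _ = _ := by rw [e1]
  · calc PowerSeries.C (p : ℤ) ^ 12 * Q ^ j = (PowerSeries.C (p : ℤ) ^ 12 * Q ^ j *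
          exq p deltaSeries * deltaInvSeries ^ p) * (deltaSeries ^ p * exq p deltaInvSeries) := by
          linear_combination (-PowerSeries.C (p : ℤ) ^ 12 * Q ^ j * (deltaSeries ^ p *
            deltaInvSeries ^ p)) * d2 - PowerSeries.C (p : ℤ) ^ 12 * Q ^ j * d1p
      _ = _ := by rw [e2]

/-- A form with a double zero at `∞`, after normalization. -/
lemma exists_normalized_of_pairForm {w : ℤ} {j N μ : ℕ} (hj : (j : ℤ) * w = 12 * (p - 1))
    (hjp : 2 * j + 1 = p ^ 2) (hμ : μ * j = 12) (hN : N ≠ 0) {R RW : ℍ → ℂ}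
    (hR : PairForm p w R RW) {P Q : PowerSeries ℤ} (hP : HasPS R (castPS P))
    (hQ : HasPS RW (castPS Q)) (h0 : P.coeff 0 = 0) (h1 : P.coeff 1 = 0) (h2 : P.coeff 2 = N)
    {t : ℤ} (ht : (p : ℤ) ^ μ * Q.constantCoeff = N * t) :
    ∃ F G S T, PairForm p w F G ∧ HasPS F (castPS (.X ^ 2 * S)) ∧ S.constantCoeff = 1 ∧
      HasPS (fun τ ↦ (p : ℂ) ^ μ * G τ) (castPS T) ∧ T.constantCoeff = t := by
  have hN' : (N : ℂ) ≠ 0 := mod_cast hN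
  have hNZ : (N : ℤ) ≠ 0 := mod_cast hN
  have hj0 : j ≠ 0 := by rintro rfl; simp at hμ
  obtain ⟨P', rfl⟩ : (PowerSeries.X : PowerSeries ℤ) ^ 2 ∣ P := by
    rw [PowerSeries.X_pow_dvd_iff]
    intro m hm
    interval_cases m <;> assumption
  have h0' : P'.constantCoeff = N := by
    rw [← h2, ← PowerSeries.coeff_zero_eq_constantCoeff_apply]
    exact (PowerSeries.coeff_X_pow_mul P' 2 0).symm
  obtain ⟨e1, e2⟩ := pow_eq_of_pairForm hj hjp hR hP hQ h0'
  obtain ⟨S, rfl⟩ := PowerSeries.exists_eq_C_mul_of_pow hj0 hN _ _ e1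
  rw [← hμ, pow_mul, ← mul_pow] at e2
  obtain ⟨T, hT⟩ := PowerSeries.exists_eq_C_mul_of_pow hj0 hN _ _ e2
  have hF := hP.const_mul (N : ℂ)⁻¹
  have hG := hQ.const_mul ((p : ℂ) ^ μ * (N : ℂ)⁻¹)
  refine ⟨_, _, S, T, hR.const_mul (N : ℂ)⁻¹, ?_, ?_, ?_, ?_⟩
  · convert hF using 1
    rw [show PowerSeries.X ^ 2 * (PowerSeries.C (N : ℤ) * S) =
      PowerSeries.C (N : ℤ) * (PowerSeries.X ^ 2 * S) by ring, map_mul castPS (PowerSeries.C _),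
      castPS_C, ← mul_assoc, ← map_mul, Int.cast_natCast, inv_mul_cancel₀ hN', map_one, one_mul]
  · rw [map_mul, PowerSeries.constantCoeff_C] at h0'
    exact mul_left_cancel₀ hNZ (h0'.trans (mul_one _).symm)
  · convert hG using 1
    · ext τ; ring
    · rw [mul_comm ((p : ℂ) ^ μ), map_mul, mul_assoc,
        show PowerSeries.C ((p : ℂ) ^ μ) = castPS (PowerSeries.C (p : ℤ) ^ μ) by simp, ← map_mul,
        hT, map_mul, castPS_C, ← mul_assoc, ← map_mul, Int.cast_natCast, inv_mul_cancel₀ hN',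
        map_one, one_mul]
  · have h := congrArg PowerSeries.constantCoeff hT
    simp only [map_mul, map_pow, PowerSeries.constantCoeff_C, ht] at h
    exact (mul_left_cancel₀ hNZ h).symm

variable (p) in
/-- The normalized weight two form on `Γ₀(p)`. -/
lemma pairForm_theta_normalized {c : ℤ} (hc : c * (p - 1) = 24) :
    PairForm p 2 (fun τ ↦ ((p : ℂ) - 1)⁻¹ * thetaForm p τ)
      (fun τ ↦ ((p : ℂ) - 1)⁻¹ * (-p * thetaForm p τ)) ∧
    HasPS (fun τ ↦ ((p : ℂ) - 1)⁻¹ * thetaForm p τ)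
      (castPS (1 + PowerSeries.C c * thetaSeries p)) := by
  have hp : (p : ℂ) - 1 ≠ 0 := by
    have := hpf.out.one_lt
    rw [sub_ne_zero]
    exact_mod_cast this.ne'
  refine ⟨(pairForm_thetaForm p).const_mul _, ?_⟩
  convert (hasPS_thetaForm p).const_mul ((p : ℂ) - 1)⁻¹ using 1
  have e : PowerSeries.C ((p : ℤ) - 1) + 24 * thetaSeries p =
      PowerSeries.C ((p : ℤ) - 1) * (1 + PowerSeries.C c * thetaSeries p) := by
    rw [show (24 : PowerSeries ℤ) = PowerSeries.C 24 by simp, ← hc, map_mul]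
    ring
  rw [e, map_mul castPS, castPS_C, ← mul_assoc, ← map_mul]
  push_cast
  rw [inv_mul_cancel₀ hp, map_one, one_mul]

lemma pairForm_E₄ : PairForm p 4 ModularForm.E₄ (fun τ ↦ (p : ℂ) ^ 4 * ModularForm.E₄ (dil p τ)) :=
  pairForm_levelOne (k := 4) (levelOne_slash ModularForm.E₄) ModularForm.E₄.holo'

lemma pairForm_E₄_dil : PairForm p 4 (fun τ ↦ ModularForm.E₄ (dil p τ)) ModularForm.E₄ :=
  pairForm_levelOne_dil (levelOne_slash ModularForm.E₄) ModularForm.E₄.holo'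

lemma pairForm_E₆ : PairForm p 6 ModularForm.E₆ (fun τ ↦ (p : ℂ) ^ 6 * ModularForm.E₆ (dil p τ)) :=
  pairForm_levelOne (k := 6) (levelOne_slash ModularForm.E₆) ModularForm.E₆.holo'

lemma pairForm_E₆_dil : PairForm p 6 (fun τ ↦ ModularForm.E₆ (dil p τ)) ModularForm.E₆ :=
  pairForm_levelOne_dil (levelOne_slash ModularForm.E₆) ModularForm.E₆.holo'

end

/-- The first three coefficients of a power series. -/
structure Jet (P : PowerSeries ℤ) (a b c : ℤ) : Prop where
  zero : P.coeff 0 = a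
  one : P.coeff 1 = b
  two : P.coeff 2 = c

namespace Jet

variable {P Q : PowerSeries ℤ} {a b c a' b' c' : ℤ}

lemma add (h : Jet P a b c) (h' : Jet Q a' b' c') : Jet (P + Q) (a + a') (b + b') (c + c') :=
  ⟨by rw [map_add, h.zero, h'.zero], by rw [map_add, h.one, h'.one], by rw [map_add, h.two, h'.two]⟩

lemma sub (h : Jet P a b c) (h' : Jet Q a' b' c') : Jet (P - Q) (a - a') (b - b') (c - c') :=
  ⟨by rw [map_sub, h.zero, h'.zero], by rw [map_sub, h.one, h'.one], by rw [map_sub, h.two, h'.two]⟩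

lemma mul (h : Jet P a b c) (h' : Jet Q a' b' c') :
    Jet (P * Q) (a * a') (a * b' + b * a') (a * c' + b * b' + c * a') := by
  have e1 : Finset.HasAntidiagonal.antidiagonal (1 : ℕ) = {(0, 1), (1, 0)} := rfl
  have e2 : Finset.HasAntidiagonal.antidiagonal (2 : ℕ) = {(0, 2), (1, 1), (2, 0)} := rfl
  refine ⟨?_, ?_, ?_⟩
  · rw [PowerSeries.coeff_mul, Finset.Nat.antidiagonal_zero, Finset.sum_singleton, h.zero, h'.zero]
  · rw [PowerSeries.coeff_mul, e1, Finset.sum_pair (by simp), h.zero, h.one, h'.zero, h'.one]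
  · rw [PowerSeries.coeff_mul, e2, Finset.sum_insert (by simp), Finset.sum_pair (by simp), h.zero,
      h.one, h.two, h'.zero, h'.one, h'.two, add_assoc]

lemma C (c : ℤ) : Jet (PowerSeries.C c) c 0 0 := by
  constructor <;> rw [PowerSeries.coeff_C] <;> rfl

lemma C_mul (d : ℤ) (h : Jet P a b c) : Jet (PowerSeries.C d * P) (d * a) (d * b) (d * c) :=
  ⟨by rw [PowerSeries.coeff_C_mul, h.zero], by rw [PowerSeries.coeff_C_mul, h.one],
    by rw [PowerSeries.coeff_C_mul, h.two]⟩

lemma one_add_C_mul (d : ℤ) (h : Jet P a b c) :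
    Jet (1 + PowerSeries.C d * P) (1 + d * a) (d * b) (d * c) := by
  simpa using (C 1).add (h.C_mul d)

lemma sigma (k : ℕ) : Jet (sigmaSeries k) 0 1 (1 + 2 ^ k) := by
  constructor
  · simp [constantCoeff_sigmaSeries]
  · simp [coeff_sigmaSeries]
  · rw [coeff_sigmaSeries, ArithmeticFunction.sigma_apply, Nat.prime_two.divisors]
    simp

variable {p : ℕ} [hpf : Fact p.Prime]

lemma theta (hp : 2 < p) : Jet (thetaSeries p) 0 1 3 := by
  refine ⟨?_, ?_, ?_⟩
  · simp [thetaSeries, constantCoeff_sigmaSeries]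
  all_goals
    rw [thetaSeries, map_sub, PowerSeries.coeff_C_mul, PowerSeries.coeff_expand_of_not_dvd]
  · simp [(sigma 1).one]
  · exact Nat.not_dvd_of_pos_of_lt one_pos (by omega)
  · simp [(sigma 1).two]
  · exact Nat.not_dvd_of_pos_of_lt two_pos hp

lemma expand (hp : 2 < p) (h : Jet P a b c) :
    Jet (PowerSeries.expand p hpf.out.ne_zero P) a 0 0 := by
  refine ⟨?_, ?_, ?_⟩
  · have := h.zero
    simpa using this
  · exact PowerSeries.coeff_expand_of_not_dvd _ _ _ (Nat.not_dvd_of_pos_of_lt one_pos (by omega))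
  · exact PowerSeries.coeff_expand_of_not_dvd _ _ _ (Nat.not_dvd_of_pos_of_lt two_pos hp)

lemma E₄ : Jet (1 + 240 * sigmaSeries 3) 1 240 2160 := by
  simpa using (sigma 3).one_add_C_mul 240

lemma E₆ : Jet (1 - 504 * sigmaSeries 5) 1 (-504) (-16632) := by
  simpa [sub_eq_add_neg] using (sigma 5).one_add_C_mul (-504)

end Jet

lemma exists_special_three [Fact (Nat.Prime 3)] :
    ∃ F G S T, PairForm 3 6 F G ∧ HasPS F (castPS (.X ^ 2 * S)) ∧ S.constantCoeff = 1 ∧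
      HasPS (fun τ ↦ ((3 : ℕ) : ℂ) ^ 3 * G τ) (castPS T) ∧ T.constantCoeff = -1 := by
  obtain ⟨hθ, hθP⟩ := pairForm_theta_normalized 3 (c := 12) (by norm_num)
  have hR := ((pairForm_E₆_dil (p := 3)).const_mul (15 : ℤ)).sub
    ((pairForm_E₆.add (((hθ.mul (hθ.mul hθ)).const_mul (14 : ℤ)).congr (by norm_num) (fun _ ↦ rfl)
    fun _ ↦ rfl)))
  have hP := ((hasPS_E₆.dil 3).cast_const_mul 15).cast_sub
    (hasPS_E₆.cast_add ((hθP.cast_mul (hθP.cast_mul hθP)).cast_const_mul 14))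
  have hQ := (hasPS_E₆.cast_const_mul 15).cast_sub
    (((hasPS_E₆.dil 3).cast_const_mul (3 ^ 6)).cast_add
    ((hθP.cast_mul (hθP.cast_mul hθP)).cast_const_mul (-378)))
  have jθ := (Jet.theta (p := 3) (by norm_num)).one_add_C_mul 12
  have jP := ((Jet.E₆.expand (p := 3) (by norm_num)).C_mul 15).sub
    (Jet.E₆.add ((jθ.mul (jθ.mul jθ)).C_mul 14))
  have jQ := (Jet.E₆.C_mul 15).sub (((Jet.E₆.expand (p := 3) (by norm_num)).C_mul (3 ^ 6)).add
    ((jθ.mul (jθ.mul jθ)).C_mul (-378)))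
  refine exists_normalized_of_pairForm (j := 4) (N := 9072) (t := -1) (μ := 3) (by norm_num)
    (by norm_num) (by norm_num) (by norm_num) hR hP (hQ.congr fun τ ↦ ?_) ?_ ?_ ?_ ?_
  · simp
    ring
  · rw [jP.zero]; norm_num
  · rw [jP.one]; norm_num
  · rw [jP.two]; norm_num
  · rw [← PowerSeries.coeff_zero_eq_constantCoeff_apply, jQ.zero]; norm_num

lemma exists_special_five [Fact (Nat.Prime 5)] :
    ∃ F G S T, PairForm 5 4 F G ∧ HasPS F (castPS (.X ^ 2 * S)) ∧ S.constantCoeff = 1 ∧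
      HasPS (fun τ ↦ ((5 : ℕ) : ℂ) ^ 1 * G τ) (castPS T) ∧ T.constantCoeff = 1 := by
  obtain ⟨hθ, hθP⟩ := pairForm_theta_normalized 5 (c := 6) (by norm_num)
  have hR := (pairForm_E₄.add ((pairForm_E₄_dil (p := 5)).const_mul (19 : ℤ))).sub
    (((hθ.mul hθ).const_mul (20 : ℤ)).congr (by norm_num) (fun _ ↦ rfl) fun _ ↦ rfl)
  have hP := (hasPS_E₄.cast_add ((hasPS_E₄.dil 5).cast_const_mul 19)).cast_sub
    ((hθP.cast_mul hθP).cast_const_mul 20)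
  have hQ := (((hasPS_E₄.dil 5).cast_const_mul (5 ^ 4)).cast_add
    (hasPS_E₄.cast_const_mul 19)).cast_sub
    ((hθP.cast_mul hθP).cast_const_mul 500)
  have jθ := (Jet.theta (p := 5) (by norm_num)).one_add_C_mul 6
  have jE := Jet.E₄.expand (p := 5) (by norm_num)
  have jP := (Jet.E₄.add (jE.C_mul 19)).sub ((jθ.mul jθ).C_mul 20)
  have jQ := ((jE.C_mul (5 ^ 4)).add (Jet.E₄.C_mul 19)).sub ((jθ.mul jθ).C_mul 500)
  refine exists_normalized_of_pairForm (j := 12) (N := 720) (t := 1) (μ := 1) (by norm_num)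
    (by norm_num) (by norm_num) (by norm_num) hR hP (hQ.congr fun τ ↦ ?_) ?_ ?_ ?_ ?_
  · simp
    ring
  · rw [jP.zero]; norm_num
  · rw [jP.one]; norm_num
  · rw [jP.two]; norm_num
  · rw [← PowerSeries.coeff_zero_eq_constantCoeff_apply, jQ.zero]; norm_num

/-- A Hauptmodul `φ = q + ⋯` of level `p` with its image `p ^ l φ_W = q⁻¹ + ⋯` under the Fricke
involution, both with integral coefficients. -/
def IsHauptmodul (p l : ℕ) [Fact p.Prime] (φ φW : ℍ → ℂ) : Prop :=
  ∃ P Q, PairForm p 0 φ φW ∧ HasPS φ (castPS (.X * P)) ∧ P.constantCoeff = 1 ∧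
    HasPS (fun τ ↦ (p : ℂ) ^ l * qexp τ * φW τ) (castPS Q) ∧ Q.constantCoeff = 1

lemma exists_isHauptmodul_two [Fact (Nat.Prime 2)] : ∃ φ φW, IsHauptmodul 2 12 φ φW := by
  have hD := ModularForm.discriminant_ne_zero
  refine ⟨_, _, exq 2 deltaSeries * deltaInvSeries, deltaSeries * exq 2 deltaInvSeries,
    ((pairForm_discriminant_dil 2).div (pairForm_discriminant 2) hD).congr (by norm_num)
      (fun _ ↦ rfl) (fun _ ↦ rfl), .of_X_pow_mul 1 ?_, ?_, .of_X_pow_mul 1 ?_, ?_⟩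
  · convert (hasPS_discriminant_dil 2).cast_mul hasPS_qexp_div_discriminant using 1
    · funext τ
      simp only [Pi.mul_apply, Pi.div_apply, Pi.pow_apply]
      ring
    · rw [← castPS_X, ← map_pow castPS, ← map_mul]
      congr 1
      ring
  · rw [map_mul, constantCoeff_exq, constantCoeff_deltaSeries, constantCoeff_deltaInvSeries,
      one_mul]
  · convert hasPS_discriminant.cast_mul (hasPS_qexp_div_discriminant_dil 2) using 1
    · funext τ
      have h1 := hD (dil 2 τ)
      simp only [Pi.mul_apply, Pi.pow_apply, Pi.div_apply, Nat.cast_ofNat]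
      field_simp
    · rw [← castPS_X, ← map_pow castPS, ← map_mul]
      congr 1
      ring
  · rw [map_mul, constantCoeff_exq, constantCoeff_deltaSeries, constantCoeff_deltaInvSeries,
      one_mul]

lemma exists_isHauptmodul_of_special {p : ℕ} [Fact p.Prime] {a μ : ℕ} {w : ℤ} {t : ℤ}
    (ha : 2 * a = p + 1) (haw : a * w = 12) (ht : t ^ a = 1)
    (h : ∃ F G S T, PairForm p w F G ∧ HasPS F (castPS (.X ^ 2 * S)) ∧ S.constantCoeff = 1 ∧
      HasPS (fun τ ↦ (p : ℂ) ^ μ * G τ) (castPS T) ∧ T.constantCoeff = t) :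
    ∃ φ φW, IsHauptmodul p (μ * a) φ φW := by
  have hD := ModularForm.discriminant_ne_zero
  obtain ⟨F, G, S, T, hFG, hF, hS, hG, hT⟩ := h
  refine ⟨_, _, S ^ a * exq p deltaInvSeries, T ^ a * deltaInvSeries,
    ((hFG.pow a).div (pairForm_discriminant_dil p) fun τ ↦ hD _).congr (by rw [haw, sub_self])
      (fun _ ↦ rfl) (fun _ ↦ rfl), .of_X_pow_mul p ?_, ?_, ?_, ?_⟩
  · convert (hF.cast_pow a).cast_mul (hasPS_qexp_div_discriminant_dil p) using 1
    · funext τ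
      simp only [Pi.mul_apply, Pi.pow_apply, Pi.div_apply]
      ring
    · rw [← castPS_X, ← map_pow castPS, ← map_mul, mul_pow, ← pow_mul, ha]
      congr 1
      ring
  · rw [map_mul, map_pow, constantCoeff_exq, hS, constantCoeff_deltaInvSeries, one_pow, one_mul]
  · refine ((hG.cast_pow a).cast_mul hasPS_qexp_div_discriminant).congr fun τ ↦ ?_
    simp only [Pi.mul_apply, Pi.pow_apply, Pi.div_apply]
    ring
  · rw [map_mul, map_pow, hT, constantCoeff_deltaInvSeries, mul_one, ht]

lemma exists_isHauptmodul {p : ℕ} [Fact p.Prime] (hp : p = 2 ∨ p = 3 ∨ p = 5) (k : ℕ) :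
    ∃ l φ φW, IsHauptmodul p l φ φW ∧ eps k p ≤ l := by
  rcases hp with rfl | rfl | rfl
  · obtain ⟨φ, φW, h⟩ := exists_isHauptmodul_two
    refine ⟨_, φ, φW, h, ?_⟩
    rw [eps, if_pos rfl]
    split_ifs <;> norm_num
  · obtain ⟨φ, φW, h⟩ := exists_isHauptmodul_of_special (a := 2) (by norm_num) (by norm_num)
      (by norm_num) exists_special_three
    refine ⟨_, φ, φW, h, ?_⟩
    rw [eps, if_neg (by norm_num), if_pos rfl]
    split_ifs <;> norm_num
  · obtain ⟨φ, φW, h⟩ := exists_isHauptmodul_of_special (a := 3) (by norm_num) (by norm_num)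
      (by norm_num) exists_special_five
    refine ⟨_, φ, φW, h, ?_⟩
    rw [eps, if_neg (by norm_num), if_neg (by norm_num)]
    norm_num

/-! ### A Sturm bound -/

section

variable {p : ℕ} [hpf : Fact p.Prime]

namespace PairForm

variable {k D : ℕ} {F G : ℍ → ℂ} {P : PowerSeries ℂ}

lemma exists_pow_mul_discriminant (h : PairForm p k F G) (hF : HasPS F (.X ^ D * P))
    (hG : IsBoundedAtImInfty G) {e : ℕ} (he : 12 * D = (p + 1) * k + e) :
    ∃ c : ℂ, (e ≠ 0 → c = 0) ∧ ∀ τ, F τ ^ (12 * (p - 1)) * ModularForm.discriminant τ ^ k =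
      c * ModularForm.discriminant (dil p τ) ^ (p * k) := by
  have hD := ModularForm.discriminant_ne_zero
  obtain ⟨r, rfl⟩ : ∃ r, p = r + 1 := ⟨p - 1, by have := hpf.out.pos; omega⟩
  have hr : r ≠ 0 := by have := hpf.out.one_lt; omega
  rw [Nat.add_sub_cancel]
  have hg := (((h.pow (12 * r)).mul ((pairForm_discriminant (r + 1)).pow k)).div
    ((pairForm_discriminant_dil (r + 1)).pow ((r + 1) * k)) fun τ ↦ pow_ne_zero _ (hD _)).congr
    (l := 0) (by push_cast; ring) (fun _ ↦ rfl) fun _ ↦ rfl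
  have hgF : HasPS (F ^ (12 * r) * ModularForm.discriminant ^ k /
      (fun τ ↦ ModularForm.discriminant (dil (r + 1) τ)) ^ ((r + 1) * k))
      (.X ^ (r * e) * (P ^ (12 * r) * castPS (deltaSeries ^ k *
        exq (r + 1) deltaInvSeries ^ ((r + 1) * k)))) := by
    refine .of_X_pow_mul ((r + 1) * ((r + 1) * k)) ?_
    convert ((hF.pow (12 * r)).mul (hasPS_discriminant.pow k)).mul
      ((hasPS_qexp_div_discriminant_dil (r + 1)).pow ((r + 1) * k)) using 1
    · funext τ
      simp only [Pi.mul_apply, Pi.pow_apply, Pi.div_apply]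
      rw [pow_mul]
      ring
    · simp only [map_mul, map_pow, castPS_X, mul_pow, ← pow_mul]
      have : D * (12 * r) + k = (r + 1) * ((r + 1) * k) + r * e := by
        linear_combination r * he
      calc _ = PowerSeries.X ^ ((r + 1) * ((r + 1) * k) + r * e) * (P ^ (12 * r) *
          (castPS deltaSeries ^ k * castPS (exq (r + 1) deltaInvSeries) ^ ((r + 1) * k))) := by ring
        _ = _ := by rw [← this]; ring
  have hdil : HasPS (fun τ ↦ (qexp τ ^ (r + 1))⁻¹ * ModularForm.discriminant (dil (r + 1) τ))
      (castPS (exq (r + 1) deltaSeries)) := by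
    refine .of_X_pow_mul (r + 1) ?_
    convert hasPS_discriminant_dil (r + 1) using 1
    · funext τ
      have := pow_ne_zero (r + 1) (qexp_ne_zero τ)
      simp only [Pi.mul_apply, Pi.pow_apply]
      field_simp
    · rw [map_mul, map_pow, castPS_X]
  have hGb : IsBoundedAtImInfty (G ^ (12 * r)) := by
    have := Asymptotics.IsBigO.pow hG (12 * r)
    simp only [Pi.one_apply, one_pow] at this
    exact this
  obtain ⟨c, hc⟩ := hg.const_of_weight_zero hgF.isBounded <| by
    refine Eq.mp (congr_arg _ ?_) (hGb.mul ((((hdil.const_mul (((r + 1 : ℕ) : ℂ) ^ 12)).pow k).mul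
      (hasPS_qexp_div_discriminant.pow ((r + 1) * k))).isBounded))
    funext τ
    have h1 := hD τ
    have h2 := qexp_ne_zero τ
    simp only [Pi.mul_apply, Pi.pow_apply, Pi.div_apply]
    rw [mul_pow, mul_pow, mul_pow, div_pow, inv_pow]
    field_simp
    ring
  refine ⟨c, fun he0 ↦ ?_, fun τ ↦ ?_⟩
  · have h1 := hgF.tendsto
    rw [show (_ : ℍ → ℂ) = fun _ ↦ c from funext hc] at h1
    rw [tendsto_nhds_unique tendsto_const_nhds h1, PowerSeries.coeff_zero_eq_constantCoeff_apply]
    simp [hr, he0]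
  · rw [← hc τ]
    simp only [Pi.mul_apply, Pi.pow_apply, Pi.div_apply]
    rw [div_mul_cancel₀ _ (pow_ne_zero _ (hD _))]

/-- A form of weight `k ≡ 2 mod 4` on `Γ₀(5)` vanishes at an elliptic point. -/
lemma exists_eq_zero_five [Fact (Nat.Prime 5)] (h : PairForm 5 k F G) (hk : k % 4 = 2) :
    ∃ τ, F τ = 0 := by
  let γ : SL(2, ℤ) := ⟨!![2, -1; 5, -2], by simp [Matrix.det_fin_two]⟩
  have hγ : γ ∈ Gamma0 5 := by
    rw [Gamma0_mem]
    simp only [γ, Matrix.of_apply, Matrix.cons_val]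
    rfl
  let z : ℍ := ⟨(2 + Complex.I) / 5, by simp⟩
  have hz : (z : ℂ) = (2 + Complex.I) / 5 := rfl
  have hd : denom γ z = Complex.I := by
    rw [ModularGroup.denom_apply, hz]
    simp [γ]
    ring
  have hfix : γ • z = z := by
    ext
    rw [UpperHalfPlane.coe_specialLinearGroup_apply, hz]
    simp [γ]
    field_simp
    linear_combination -Complex.I_sq
  have h1 := h.map_smul γ hγ z
  rw [hfix, hd, zpow_natCast, show k = 4 * (k / 4) + 2 by omega, pow_add, pow_mul,
    Complex.I_pow_four, one_pow, Complex.I_sq] at h1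
  exact ⟨z, by linear_combination h1 / 2⟩

lemma eq_zero_of_sturm (h : PairForm p k F G) (hF : HasPS F (.X ^ D * P))
    (hG : IsBoundedAtImInfty G)
    (hD : (p + 1) * k < 12 * D ∨ (p = 5 ∧ k % 4 = 2 ∧ (p + 1) * k = 12 * D)) : F = 0 := by
  have hΔ := ModularForm.discriminant_ne_zero
  obtain ⟨c, hc0, hc⟩ := h.exists_pow_mul_discriminant hF hG (e := 12 * D - (p + 1) * k) (by omega)
  have hc' : c = 0 := by
    rcases hD with hD | ⟨rfl, hk, -⟩
    · exact hc0 (by omega)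
    · obtain ⟨τ, hτ⟩ := h.exists_eq_zero_five hk
      have := hc τ
      rw [hτ, zero_pow (by norm_num), zero_mul, eq_comm, mul_eq_zero] at this
      exact this.resolve_right (pow_ne_zero _ (hΔ _))
  funext τ
  have := hc τ
  rw [hc', zero_mul, mul_eq_zero] at this
  exact eq_zero_of_pow_eq_zero (this.resolve_right (pow_ne_zero _ (hΔ _)))

end PairForm

end

/-! ### Integral echelon forms on `Γ₀(p)` -/

/-- There is an integral holomorphic form `q ^ r + ⋯` of weight `k` on `Γ₀(p)`. -/
def HasEchelon (p : ℕ) [Fact p.Prime] (k : ℤ) (r : ℕ) : Prop :=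
  ∃ F G Q, PairForm p k F G ∧ HasPS F (castPS (.X ^ r * Q)) ∧ Q.constantCoeff = 1 ∧
    IsBoundedAtImInfty G

section

variable {p : ℕ} [hpf : Fact p.Prime] {k l : ℤ} {r s R S : ℕ}

lemma HasEchelon.mul (h : HasEchelon p k r) (h' : HasEchelon p l s) :
    HasEchelon p (k + l) (r + s) := by
  obtain ⟨F, G, Q, h1, h2, h3, h4⟩ := h
  obtain ⟨F', G', Q', h1', h2', h3', h4'⟩ := h'
  refine ⟨F * F', G * G', Q * Q', h1.mul h1', ?_, by rw [map_mul, h3, h3', one_mul], h4.mul h4'⟩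
  convert h2.cast_mul h2' using 2
  ring

lemma forall_hasEchelon_mul (h : ∀ r ≤ R, HasEchelon p k r) (h' : ∀ r ≤ S, HasEchelon p l r) :
    ∀ r ≤ R + S, HasEchelon p (k + l) r := fun r hr ↦ by
  have := (h (min r R) (by omega)).mul (h' (r - min r R) (by omega))
  rwa [show min r R + (r - min r R) = r by omega] at this

lemma forall_hasEchelon_two (h : ∀ r ≤ 1, HasEchelon p k r) (h' : HasEchelon p k 2) :
    ∀ r ≤ 2, HasEchelon p k r := fun r hr ↦ by
  rcases Nat.lt_or_ge 1 r with h1 | h1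
  · rwa [show r = 2 by omega]
  · exact h r h1

lemma forall_hasEchelon_one_of_levelOne {f G : ℍ → ℂ} (h : PairForm p k f G)
    (h' : PairForm p k (fun τ ↦ f (dil p τ)) f) (hG : IsBoundedAtImInfty G) {c : ℤ} (hc : c ≠ 0)
    {T : PowerSeries ℤ} (hf : HasPS f (castPS (1 + PowerSeries.C c * T)))
    (h0 : T.constantCoeff = 0) (h1 : T.coeff 1 = 1) : ∀ r ≤ 1, HasEchelon p k r := by
  have hc' : (c : ℂ) ≠ 0 := mod_cast hc
  intro r hr
  interval_cases r
  · exact ⟨f, G, _, h, by rwa [pow_zero, one_mul], by simp [h0], hG⟩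
  · obtain ⟨Q, hQ⟩ : PowerSeries.X ∣ T - exq p T := by
      rw [PowerSeries.X_dvd_iff, map_sub, constantCoeff_exq, sub_self]
    refine ⟨_, _, Q, (h.sub h').const_mul (c : ℂ)⁻¹, ?_, ?_, ?_⟩
    · convert (hf.sub (hf.dil p)).const_mul (c : ℂ)⁻¹ using 1
      rw [pow_one, ← hQ, ← map_sub]
      have : (1 + PowerSeries.C c * T - PowerSeries.expand p hpf.out.ne_zero
          (1 + PowerSeries.C c * T)) = PowerSeries.C c * (T - exq p T) := by
        rw [map_add, map_one, map_mul, PowerSeries.expand_C]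
        ring
      rw [this, map_mul, castPS_C, ← mul_assoc, ← map_mul, inv_mul_cancel₀ hc', map_one, one_mul]
    · have := congr_arg (PowerSeries.coeff 1) hQ
      rw [map_sub, h1, PowerSeries.coeff_expand_of_not_dvd _ _ _ (by
        simpa using hpf.out.ne_one), sub_zero, ← zero_add 1, PowerSeries.coeff_succ_X_mul] at this
      rw [← PowerSeries.coeff_zero_eq_constantCoeff_apply, ← this, zero_add]
    · exact (HasPS.const (c : ℂ)⁻¹).isBounded.mul (hG.sub hf.isBounded)

lemma forall_hasEchelon_four : ∀ r ≤ 1, HasEchelon p 4 r :=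
  forall_hasEchelon_one_of_levelOne pairForm_E₄ pairForm_E₄_dil
    ((hasPS_E₄.dil p).const_mul _).isBounded (c := 240) (by norm_num) hasPS_E₄
    (constantCoeff_sigmaSeries 3) (coeff_one_sigmaSeries 3)

lemma forall_hasEchelon_six : ∀ r ≤ 1, HasEchelon p 6 r :=
  forall_hasEchelon_one_of_levelOne pairForm_E₆ pairForm_E₆_dil
    ((hasPS_E₆.dil p).const_mul _).isBounded (c := -504) (by norm_num)
    (by convert hasPS_E₆ using 2; rw [map_neg, neg_mul, ← sub_eq_add_neg]; rfl)
    (constantCoeff_sigmaSeries 5) (coeff_one_sigmaSeries 5)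

lemma hasEchelon_two_of_special {μ : ℕ} (h : ∃ F G S T, PairForm p k F G ∧
    HasPS F (castPS (.X ^ 2 * S)) ∧ S.constantCoeff = 1 ∧
      HasPS (fun τ ↦ (p : ℂ) ^ μ * G τ) (castPS T) ∧ T.constantCoeff = l) :
    HasEchelon p k 2 := by
  obtain ⟨F, G, S, T, h1, h2, h3, h4, -⟩ := h
  have hp : (p : ℂ) ^ μ ≠ 0 := pow_ne_zero _ (mod_cast hpf.out.ne_zero)
  refine ⟨F, G, S, h1, h2, h3, ?_⟩
  refine ((h4.const_mul ((p : ℂ) ^ μ)⁻¹).congr fun τ ↦ ?_).isBounded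
  field_simp

lemma hasEchelon_theta {c : ℤ} (hc : c * (p - 1) = 24) : HasEchelon p 2 0 := by
  obtain ⟨h1, h2⟩ := pairForm_theta_normalized p hc
  refine ⟨_, _, _, h1, by rw [pow_zero, one_mul]; exact h2, ?_, ?_⟩
  · simp [thetaSeries, constantCoeff_sigmaSeries]
  · refine ((h2.const_mul (-p : ℂ)).congr fun τ ↦ ?_).isBounded
    ring

end

lemma exists_forall_hasEchelon {p k : ℕ} [Fact p.Prime] (hp : p = 2 ∨ p = 3 ∨ p = 5)
    (hk : k = 4 ∨ k = 6 ∨ k = 8 ∨ k = 10 ∨ k = 14) :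
    ∃ D : ℕ, (∀ r < D, HasEchelon p k r) ∧
      ((p + 1) * k < 12 * D ∨ (p = 5 ∧ k % 4 = 2 ∧ (p + 1) * k = 12 * D)) := by
  suffices H : ∃ a b : ℕ, (∀ r ≤ a, HasEchelon p 4 r) ∧ (∀ r ≤ b, HasEchelon p 6 r) ∧
      a = (if p = 5 then 2 else 1) ∧ b = (if p = 2 then 1 else 2) by
    obtain ⟨a, b, ha, hb, ha', hb'⟩ := H
    rcases hk with rfl | rfl | rfl | rfl | rfl
    · refine ⟨a + 1, fun r hr ↦ ha r (by omega), ?_⟩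
      rcases hp with rfl | rfl | rfl <;> norm_num at ha' <;> subst ha' <;> norm_num
    · refine ⟨b + 1, fun r hr ↦ hb r (by omega), ?_⟩
      rcases hp with rfl | rfl | rfl <;> norm_num at hb' <;> subst hb' <;> norm_num
    · refine ⟨a + a + 1, fun r hr ↦ forall_hasEchelon_mul ha ha r (by omega), ?_⟩
      rcases hp with rfl | rfl | rfl <;> norm_num at ha' <;> subst ha' <;> norm_num
    · refine ⟨a + b + 1, fun r hr ↦ forall_hasEchelon_mul ha hb r (by omega), ?_⟩
      rcases hp with rfl | rfl | rfl <;> norm_num at ha' hb' <;> subst ha' hb' <;> norm_num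
    · refine ⟨a + a + b + 1, fun r hr ↦
        forall_hasEchelon_mul (forall_hasEchelon_mul ha ha) hb r (by omega), ?_⟩
      rcases hp with rfl | rfl | rfl <;> norm_num at ha' hb' <;> subst ha' hb' <;> norm_num
  rcases hp with rfl | rfl | rfl
  · exact ⟨1, 1, forall_hasEchelon_four, forall_hasEchelon_six, by norm_num, by norm_num⟩
  · exact ⟨1, 2, forall_hasEchelon_four, forall_hasEchelon_two forall_hasEchelon_six
      (hasEchelon_two_of_special exists_special_three), by norm_num, by norm_num⟩
  · have h := hasEchelon_two_of_special exists_special_five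
    exact ⟨2, 2, forall_hasEchelon_two forall_hasEchelon_four h,
      forall_hasEchelon_two forall_hasEchelon_six (h.mul (hasEchelon_theta (c := 6) (by norm_num))),
      by norm_num, by norm_num⟩

/-! ### The dimension of `M_k(Γ₀(p))` -/

section

variable {p : ℕ} [hpf : Fact p.Prime] {k D : ℕ}

lemma PairForm.vadd {k : ℤ} {F G : ℍ → ℂ} (h : PairForm p k F G) (τ : ℍ) :
    F ((1 : ℝ) +ᵥ τ) = F τ := by
  have h1 := h.map_smul ModularGroup.T (by simp [Gamma0_mem, ModularGroup.coe_T]) τ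
  rw [ModularGroup.denom_apply, UpperHalfPlane.modular_T_smul] at h1
  simpa [ModularGroup.T] using h1

lemma ModularForm.hasPS (f : ModularForm (Gamma0 p) (k : ℤ)) : HasPS f (qExpansion 1 f) := by
  obtain ⟨G, h, hf, -⟩ := ModularForm.exists_pairForm f
  exact hasPS_of_isBounded h.vadd h.holo hf

/-- The first `D` coefficients of the `q`-expansion. -/
def firstCoeffs (p k D : ℕ) [Fact p.Prime] :
    ModularForm (Gamma0 p) (k : ℤ) →ₗ[ℂ] (Fin D → ℂ) where
  toFun f n := (qExpansion 1 f).coeff n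
  map_add' f g := by
    ext n
    rw [(ModularForm.hasPS (f + g)).unique ((ModularForm.hasPS f).add (ModularForm.hasPS g)),
      map_add, Pi.add_apply]
  map_smul' c f := by
    ext n
    rw [(ModularForm.hasPS (c • f)).unique ((ModularForm.hasPS f).const_mul c),
      PowerSeries.coeff_C_mul, Pi.smul_apply, smul_eq_mul, RingHom.id_apply]

lemma firstCoeffs_injective
    (hD : (p + 1) * k < 12 * D ∨ (p = 5 ∧ k % 4 = 2 ∧ (p + 1) * k = 12 * D)) :
    Function.Injective (firstCoeffs p k D) := by
  rw [injective_iff_map_eq_zero]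
  intro f hf
  obtain ⟨G, h, -, hG⟩ := ModularForm.exists_pairForm f
  obtain ⟨P, hP⟩ : PowerSeries.X ^ D ∣ qExpansion 1 f := by
    rw [PowerSeries.X_pow_dvd_iff]
    exact fun m hm ↦ congr_fun hf ⟨m, hm⟩
  exact DFunLike.coe_injective (h.eq_zero_of_sturm (hP ▸ ModularForm.hasPS f) hG hD)

lemma le_finrank (hE : ∀ r < D, HasEchelon p k r)
    (hD : (p + 1) * k < 12 * D ∨ (p = 5 ∧ k % 4 = 2 ∧ (p + 1) * k = 12 * D)) :
    D ≤ Module.finrank ℂ (ModularForm (Gamma0 p) (k : ℤ)) := by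
  have hinj := firstCoeffs_injective hD
  have := Module.Finite.of_injective _ hinj
  choose F G Q h hF hQ hG using fun r : Fin D ↦ hE r r.2
  let f (r : Fin D) := (h r).toModularForm (hF r).isBounded (hG r)
  have hM : ∀ r s, firstCoeffs p k D (f r) s =
      ((PowerSeries.coeff s (PowerSeries.X ^ (r : ℕ) * Q r) : ℤ) : ℂ) := by
    intro r s
    have : HasPS (f r) (castPS (.X ^ (r : ℕ) * Q r)) := hF r
    change (qExpansion 1 (f r)).coeff s = _
    rw [(ModularForm.hasPS (f r)).unique this, coeff_castPS]
  have hdet : (Matrix.of fun r ↦ firstCoeffs p k D (f r)).det = 1 := by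
    rw [Matrix.det_of_isUpperTriangular, Finset.prod_eq_one]
    · intro r _
      rw [Matrix.of_apply, hM, PowerSeries.coeff_X_pow_mul', if_pos le_rfl, Nat.sub_self,
        PowerSeries.coeff_zero_eq_constantCoeff_apply, hQ, Int.cast_one]
    · intro r s hrs
      have : ¬ (r : ℕ) ≤ s := not_le.mpr hrs
      rw [Matrix.of_apply, hM, PowerSeries.coeff_X_pow_mul', if_neg this, Int.cast_zero]
  have hli : LinearIndependent ℂ (firstCoeffs p k D ∘ f) :=
    Matrix.linearIndependent_rows_iff_isUnit.mpr
      ((Matrix.isUnit_iff_isUnit_det _).mpr (hdet ▸ isUnit_one))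
  simpa using hli.of_comp.fintype_card_le_finrank

end

/-! ### Removing the pole at the cusp `0` -/

section

variable {p : ℕ} [hpf : Fact p.Prime]

/-- `E` is an integral form `1 + O(q)` of level one and weight `k`, viewed on `Γ₀(p)`. -/
def IsUnitForm (p : ℕ) [Fact p.Prime] (k : ℤ) (E : ℍ → ℂ) : Prop :=
  PairForm p k (fun τ ↦ E (dil p τ)) E ∧ ∃ T, HasPS E (castPS T) ∧ T.constantCoeff = 1

lemma IsUnitForm.mul {k l : ℤ} {E E' : ℍ → ℂ} (h : IsUnitForm p k E) (h' : IsUnitForm p l E') :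
    IsUnitForm p (k + l) (E * E') := by
  obtain ⟨h1, T, h2, h3⟩ := h
  obtain ⟨h1', T', h2', h3'⟩ := h'
  exact ⟨h1.mul h1', T * T', h2.cast_mul h2', by rw [map_mul, h3, h3', one_mul]⟩

lemma isUnitForm_E₄ : IsUnitForm p 4 ModularForm.E₄ :=
  ⟨pairForm_E₄_dil, _, hasPS_E₄, by simp [constantCoeff_sigmaSeries]⟩

lemma isUnitForm_E₆ : IsUnitForm p 6 ModularForm.E₆ :=
  ⟨pairForm_E₆_dil, _, hasPS_E₆, by simp [constantCoeff_sigmaSeries]⟩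

lemma exists_isUnitForm {k : ℕ} (hk : k = 4 ∨ k = 6 ∨ k = 8 ∨ k = 10 ∨ k = 14) :
    ∃ E, IsUnitForm p k E := by
  have h4 := isUnitForm_E₄ (p := p)
  have h6 := isUnitForm_E₆ (p := p)
  rcases hk with rfl | rfl | rfl | rfl | rfl
  · exact ⟨_, h4⟩
  · exact ⟨_, h6⟩
  · exact ⟨_, h4.mul h4⟩
  · exact ⟨_, h4.mul h6⟩
  · exact ⟨_, (h4.mul h4).mul h6⟩

lemma PairForm.exists_bounded {k : ℤ} {l e : ℕ} {φ φW E : ℍ → ℂ} (hφ : IsHauptmodul p l φ φW)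
    (hE : IsUnitForm p k E) (hel : e ≤ l) (M : ℕ) : ∀ {F G : ℍ → ℂ} {P Q : PowerSeries ℤ},
    PairForm p k F G → HasPS F (castPS P) → HasPS (qexp ^ M * G) (castPS Q) →
    ∃ F' G' P', PairForm p k F' G' ∧ HasPS F' (castPS P') ∧ IsBoundedAtImInfty G' ∧
      ∀ n, (p : ℤ) ^ e ∣ PowerSeries.coeff n (P' - P) := by
  obtain ⟨Pφ, Qφ, h1, h2, -, h3, h4⟩ := hφ
  obtain ⟨h5, T, h6, h7⟩ := hE
  induction M with
  | zero =>
    intro F G P Q h hF hG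
    rw [pow_zero, one_mul] at hG
    exact ⟨F, G, P, h, hF, hG.isBounded, by simp⟩
  | succ M ih =>
    intro F G P Q h hF hG
    let b : ℤ := Q.constantCoeff
    obtain ⟨Q', hQ'⟩ : PowerSeries.X ∣ Q - PowerSeries.C b * (T * Qφ ^ (M + 1)) := by
      rw [PowerSeries.X_dvd_iff]
      simp [b, h7, h4]
    let c : ℤ := b * p ^ (l * (M + 1))
    have hF' := hF.cast_sub (((h6.dil p).cast_mul (h2.cast_pow (M + 1))).cast_const_mul c)
    have hPF := h.sub (((h5.mul (h1.pow (M + 1))).congr (l := k) (by simp)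
      (fun _ ↦ rfl) (fun _ ↦ rfl)).const_mul (c : ℂ))
    obtain ⟨F'', G'', P'', k1, k2, k3, k4⟩ := ih (Q := Q') hPF hF' (by
      refine .of_X_pow_mul 1 ?_
      rw [pow_one, pow_one, ← castPS_X, ← map_mul, ← hQ']
      refine (hG.cast_sub ((h6.cast_mul (h3.cast_pow (M + 1))).cast_const_mul b)).congr fun τ ↦ ?_
      simp only [Pi.mul_apply, Pi.sub_apply, Pi.pow_apply, c]
      push_cast
      rw [mul_pow, mul_pow, pow_mul]
      ring)
    refine ⟨F'', G'', P'', k1, k2, k3, fun n ↦ ?_⟩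
    have h8 : (p : ℤ) ^ e ∣ c :=
      dvd_mul_of_dvd_right (pow_dvd_pow _ (hel.trans (Nat.le_mul_of_pos_right _ M.succ_pos))) _
    have h9 := dvd_sub (k4 n) (Dvd.dvd.mul_right h8 (PowerSeries.coeff n
      (PowerSeries.expand p hpf.out.ne_zero T * (.X * Pφ) ^ (M + 1))))
    rw [← PowerSeries.coeff_C_mul, ← map_sub] at h9
    rwa [sub_sub, sub_add_cancel] at h9

end

/-! ### The constant term of a weakly holomorphic form of weight two -/

lemma mem_ball_two_I {z : ℂ} : z ∈ Metric.ball (2 * Complex.I) √3 ↔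
    z.re ^ 2 + z.im ^ 2 + 1 < 4 * z.im := by
  rw [mem_ball_iff_norm, Real.lt_sqrt (norm_nonneg _), Complex.sq_norm, Complex.normSq_apply]
  simp only [Complex.sub_re, Complex.sub_im, Complex.mul_re, Complex.mul_im, Complex.re_ofNat,
    Complex.im_ofNat, Complex.I_re, Complex.I_im]
  constructor <;> intro h <;> nlinarith

lemma im_pos_of_mem_ball_two_I {z : ℂ} (hz : z ∈ Metric.ball (2 * Complex.I) √3) : 0 < z.im := by
  rw [mem_ball_two_I] at hz
  nlinarith [sq_nonneg z.re, sq_nonneg z.im]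

lemma neg_inv_mem_ball_two_I {z : ℂ} (hz : z ∈ Metric.ball (2 * Complex.I) √3) :
    -z⁻¹ ∈ Metric.ball (2 * Complex.I) √3 := by
  have h0 := im_pos_of_mem_ball_two_I hz
  rw [mem_ball_two_I] at hz ⊢
  have h1 : 0 < z.re ^ 2 + z.im ^ 2 := by positivity
  have h2 : Complex.normSq z = z.re ^ 2 + z.im ^ 2 := by rw [Complex.normSq_apply]; ring
  simp only [Complex.neg_re, Complex.neg_im, Complex.inv_re, Complex.inv_im, h2]
  rw [show (-(z.re / (z.re ^ 2 + z.im ^ 2))) ^ 2 + (-(-z.im / (z.re ^ 2 + z.im ^ 2))) ^ 2 + 1 =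
    (z.re ^ 2 + z.im ^ 2 + 1) / (z.re ^ 2 + z.im ^ 2) by field_simp; ring,
    show 4 * -(-z.im / (z.re ^ 2 + z.im ^ 2)) = 4 * z.im / (z.re ^ 2 + z.im ^ 2) by ring]
  gcongr

lemma integral_eq_zero_of_neg_inv {h : ℂ → ℂ}
    (hd : DifferentiableOn ℂ h (Metric.ball (2 * Complex.I) √3))
    (hS : ∀ z : ℂ, 0 < z.im → h (-z⁻¹) = z ^ 2 * h z) :
    ∫ u in (-1 / 2 : ℝ)..(1 / 2), h (u + (√3 / 2 : ℝ) * Complex.I) = 0 := by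
  obtain ⟨G, hG⟩ := hd.isExactOn_ball
  set B := Metric.ball (2 * Complex.I) √3
  have h3 : √3 ^ 2 = 3 := Real.sq_sqrt (by norm_num)
  have h3' : 1.7 < √3 := by rw [Real.lt_sqrt] <;> norm_num
  have hseg : ∀ u : ℝ, |u| ≤ 1 / 2 → (u + (√3 / 2 : ℝ) * Complex.I : ℂ) ∈ B := by
    intro u hu
    rw [abs_le] at hu
    rw [mem_ball_two_I]
    simp only [Complex.add_re, Complex.add_im, Complex.ofReal_re, Complex.ofReal_im, Complex.mul_re,
      Complex.mul_im, Complex.I_re, Complex.I_im]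
    nlinarith
  have hU : ∀ z ∈ B, HasDerivAt (fun z ↦ G (-z⁻¹) - G z) 0 z := by
    intro z hz
    have hz0 := im_pos_of_mem_ball_two_I hz
    have hz1 : z ≠ 0 := by rintro rfl; simp at hz0
    have h1 := ((hG _ (neg_inv_mem_ball_two_I hz)).comp z (hasDerivAt_inv hz1).neg).sub (hG z hz)
    refine h1.congr_deriv ?_
    rw [hS z hz0]
    field_simp
    simp
  have hconst := Metric.isOpen_ball.is_const_of_deriv_eq_zero (convex_ball _ _).isPreconnected
    (fun z hz ↦ (hU z hz).differentiableAt.differentiableWithinAt) (fun z hz ↦ (hU z hz).deriv)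
    (x := Complex.I) (y := ((-1 / 2 : ℝ) + (√3 / 2 : ℝ) * Complex.I : ℂ))
    (by rw [mem_ball_two_I]; norm_num) (hseg _ (by rw [abs_le]; norm_num))
  have hrho : -((-1 / 2 : ℝ) + (√3 / 2 : ℝ) * Complex.I : ℂ)⁻¹ =
      ((1 / 2 : ℝ) + (√3 / 2 : ℝ) * Complex.I : ℂ) := by
    have h4 : ((√3 : ℝ) : ℂ) ^ 2 = 3 := by exact_mod_cast h3
    rw [neg_eq_iff_eq_neg]
    refine inv_eq_of_mul_eq_one_right ?_
    push_cast
    linear_combination -((√3 : ℝ) : ℂ) ^ 2 / 4 * Complex.I_sq + h4 / 4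
  rw [hrho, Complex.inv_I, neg_neg, sub_self] at hconst
  have hder : ∀ u ∈ Set.uIcc (-1 / 2 : ℝ) (1 / 2),
      HasDerivAt (fun u : ℝ ↦ G (u + (√3 / 2 : ℝ) * Complex.I))
        (h (u + (√3 / 2 : ℝ) * Complex.I)) u := by
    intro u hu
    rw [Set.uIcc_of_le (by norm_num), Set.mem_Icc] at hu
    have h1 := hG _ (hseg u (abs_le.mpr ⟨by linarith, by linarith⟩))
    have h2 : HasDerivAt (fun u : ℝ ↦ (u + (√3 / 2 : ℝ) * Complex.I : ℂ)) 1 u :=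
      (Complex.ofRealCLM.hasDerivAt).add_const _
    exact (h1.comp u h2).congr_deriv (mul_one _)
  rw [intervalIntegral.integral_eq_sub_of_hasDerivAt hder, ← sub_eq_zero.mp hconst.symm, sub_self]
  refine ContinuousOn.intervalIntegrable (hd.continuousOn.comp (by fun_prop) ?_)
  intro u hu
  rw [Set.uIcc_of_le (by norm_num), Set.mem_Icc] at hu
  exact hseg u (abs_le.mpr ⟨by linarith, by linarith⟩)

/-- The constant term of a weakly holomorphic form of weight two and level one vanishes. -/
lemma coeff_eq_zero_of_weight_two {H : ℍ → ℂ} (hH : MDifferentiable 𝓘(ℂ) 𝓘(ℂ) H)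
    (hsl : ∀ γ : SL(2, ℤ), H ∣[(2 : ℤ)] γ = H) {N : ℕ} {P : PowerSeries ℂ}
    (hP : HasPS (qexp ^ N * H) P) : P.coeff N = 0 := by
  have hper := periodic_of_vadd (levelOne_vadd hsl)
  have hhol : MDifferentiable 𝓘(ℂ) 𝓘(ℂ) (qexp ^ N * H) := (mdifferentiable_qexp.pow N).mul hH
  rw [hP.unique (hasPS_of_isBounded hP.vadd hhol hP.isBounded),
    qExpansion_coeff_eq_intervalIntegral one_pos (by simpa using periodic_of_vadd hP.vadd) hhol
      hP.isBounded N (t := √3 / 2) (by positivity)]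
  have e : ∀ u : ℝ, 1 / Function.Periodic.qParam 1 (u + (√3 / 2 : ℝ) * Complex.I) ^ N *
      (qexp ^ N * H) ⟨u + (√3 / 2 : ℝ) * Complex.I, by simp⟩ =
      (H ∘ ofComplex) (u + (√3 / 2 : ℝ) * Complex.I) := by
    intro u
    let τ : ℍ := ⟨u + (√3 / 2 : ℝ) * Complex.I, by simp⟩
    have h1 := pow_ne_zero N (qexp_ne_zero τ)
    have h2 : (τ : ℂ) = u + (√3 / 2 : ℝ) * Complex.I := rfl
    change 1 / Function.Periodic.qParam 1 (τ : ℂ) ^ N * (qexp τ ^ N * H τ) = _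
    rw [Function.comp_apply, ← h2, ofComplex_apply, ← qexp_eq_qParam]
    field_simp
  simp only [UpperHalfPlane.coe_I, e]
  have hper' : Function.Periodic (fun u : ℝ ↦ (H ∘ ofComplex) (u + (√3 / 2 : ℝ) * Complex.I))
      1 := by
    intro u
    refine Eq.trans ?_ (hper (u + (√3 / 2 : ℝ) * Complex.I))
    simp only [Complex.ofReal_add, Complex.ofReal_one]
    congr 1
    ring
  have h1 := hper'.intervalIntegral_add_eq 0 (-1 / 2)
  rw [zero_add, show (-1 / 2 + 1 : ℝ) = 1 / 2 by norm_num] at h1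
  rw [h1, integral_eq_zero_of_neg_inv, mul_zero]
  · exact (UpperHalfPlane.mdifferentiable_iff.mp hH).mono fun z hz ↦ im_pos_of_mem_ball_two_I hz
  · intro z hz
    have h2 := levelOne_smul hsl ModularGroup.S ⟨z, hz⟩
    rw [denom_S_eq] at h2
    have h3 : -z⁻¹ = ((ModularGroup.S • (⟨z, hz⟩ : ℍ) : ℍ) : ℂ) :=
      (S_smul_coe ⟨z, hz⟩).symm
    rw [Function.comp_apply, Function.comp_apply, h3, ofComplex_apply, h2,
      ofComplex_apply_of_im_pos hz]
    rfl

/-! ### Duality -/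

lemma HasExpansion.hasPS {f : ℍ → ℂ} {c : ℤ → ℂ} (h : HasExpansion f c) (N : ℕ)
    (h0 : ∀ n : ℤ, n < -N → c n = 0) :
    HasPS (qexp ^ N * f) (PowerSeries.mk fun n ↦ c (n - N)) := by
  intro τ
  have h1 := (h.2 τ).mul_left (qexp τ ^ N)
  rw [← (Equiv.subRight (N : ℤ)).hasSum_iff, ← (Nat.cast_injective (R := ℤ)).hasSum_iff] at h1
  · refine h1.congr_fun fun n ↦ ?_
    have := qexp_ne_zero τ
    simp only [Function.comp_apply, Equiv.subRight_apply, PowerSeries.coeff_mk]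
    rw [zpow_sub₀ this, zpow_natCast, zpow_natCast]
    field_simp
  · intro n hn
    have hn : n < 0 := by
      by_contra! h2
      exact hn ⟨n.toNat, Int.toNat_of_nonneg h2⟩
    simp only [Function.comp_apply, Equiv.subRight_apply]
    rw [h0 _ (by omega), zero_mul, mul_zero]

lemma WhmForm.slash_top {k : ℤ} (f : WhmForm ⊤ k) (γ : SL(2, ℤ)) : f.toFun ∣[k] γ = f.toFun :=
  f.slash_eq γ (Subgroup.mem_top γ)

lemma WhmForm.coeff_duality {k : ℤ} {f : WhmForm ⊤ k} {g : WhmForm ⊤ (2 - k)} {m j : ℕ}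
    (hm : 0 < m) (hj : 0 < j) (hf : IsBasisElt k 0 m f) (hg : IsBasisElt (2 - k) (-1) j g) :
    f.coeff j = -g.coeff m := by
  have hF := f.expansion.hasPS m fun n hn ↦ hf.2 n (by omega) (by omega)
  have hG := g.expansion.hasPS j fun n hn ↦ hg.2 n (by omega) (by omega)
  have hFG : HasPS (qexp ^ (m + j) * (f.toFun * g.toFun)) _ :=
    (hF.mul hG).congr fun τ ↦ by simp only [Pi.mul_apply, Pi.pow_apply]; ring
  have h := coeff_eq_zero_of_weight_two (f.holo.mul g.holo) (fun γ ↦ by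
    have := ModularForm.mul_slash_SL2 k (2 - k) γ f.toFun g.toFun
    rwa [f.slash_top, g.slash_top, add_sub_cancel] at this) hFG
  rw [PowerSeries.coeff_mul, Finset.sum_eq_add (0, m + j) (m + j, 0)] at h
  · simp only [PowerSeries.coeff_mk, Nat.cast_add, Nat.cast_zero, zero_sub, add_sub_cancel_right,
      add_sub_cancel_left] at h
    rw [hf.1, hg.1] at h
    linear_combination h
  · simp [hm.ne']
  · rintro ⟨a, b⟩ hab hne
    rw [Finset.HasAntidiagonal.mem_antidiagonal] at hab
    simp only at hab
    simp only [PowerSeries.coeff_mk]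
    rcases Nat.lt_or_ge m a with h1 | h1
    · have hb : b ≠ 0 := by rintro rfl; exact hne.2 (by simp [← hab])
      rw [hg.2 _ (by omega) (by omega), mul_zero]
    · have ha : a ≠ 0 := by rintro rfl; exact hne.1 (by simp [← hab])
      rw [hf.2 _ (by omega) (by omega), zero_mul]
  · intro h1
    exact absurd (Finset.HasAntidiagonal.mem_antidiagonal.mpr (by simp)) h1
  · intro h1
    exact absurd (Finset.HasAntidiagonal.mem_antidiagonal.mpr (by simp)) h1

/-! ### Congruences between coefficients -/

section

variable {p : ℕ} [hpf : Fact p.Prime] {k D : ℕ}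

/-- An integral form whose first `D` coefficients are divisible by `N` is divisible by `N`. -/
lemma PairForm.dvd_coeff (hE : ∀ r < D, HasEchelon p k r)
    (hD : (p + 1) * k < 12 * D ∨ (p = 5 ∧ k % 4 = 2 ∧ (p + 1) * k = 12 * D)) {F G : ℍ → ℂ}
    {P : PowerSeries ℤ} (h : PairForm p k F G) (hF : HasPS F (castPS P))
    (hG : IsBoundedAtImInfty G) {N : ℤ} (hN : ∀ r < D, N ∣ P.coeff r) (n : ℕ) :
    N ∣ P.coeff n := by
  suffices H : ∀ s ≤ D, ∃ F' G' Q, PairForm p k F' G' ∧ HasPS F' (castPS (.X ^ s * Q)) ∧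
      IsBoundedAtImInfty G' ∧ ∀ n, N ∣ PowerSeries.coeff n (P - .X ^ s * Q) by
    obtain ⟨F', G', Q, h1, h2, h3, h4⟩ := H D le_rfl
    have h5 := h2
    rw [map_mul, map_pow, castPS_X] at h5
    have h6 := h1.eq_zero_of_sturm h5 h3 hD
    rw [h6] at h2
    have h7 : PowerSeries.X ^ D * Q = 0 :=
      castPS_injective (by rw [h2.eq_zero_of_eq_zero, map_zero])
    have := h4 n
    rwa [h7, sub_zero] at this
  intro s
  induction s with
  | zero => exact fun _ ↦ ⟨F, G, P, h, by rwa [pow_zero, one_mul], hG, by simp⟩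
  | succ s ih =>
    intro hs
    obtain ⟨F', G', Q, h1, h2, h3, h4⟩ := ih (by omega)
    obtain ⟨F₀, G₀, Q₀, k1, k2, k3, k4⟩ := hE s hs
    let c := Q.constantCoeff
    have hc : N ∣ c := by
      have := dvd_sub (hN s hs) (h4 s)
      rwa [map_sub, sub_sub_cancel, PowerSeries.coeff_X_pow_mul', if_pos le_rfl, Nat.sub_self,
        PowerSeries.coeff_zero_eq_constantCoeff_apply] at this
    obtain ⟨R, hR⟩ : PowerSeries.X ∣ Q - PowerSeries.C c * Q₀ := by
      rw [PowerSeries.X_dvd_iff]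
      simp [c, k3]
    have e : PowerSeries.X ^ (s + 1) * R = .X ^ s * Q - PowerSeries.C c * (.X ^ s * Q₀) := by
      rw [pow_succ, mul_assoc, ← hR]
      ring
    refine ⟨_, _, R, h1.sub (k1.const_mul (c : ℂ)), ?_,
      h3.sub ((HasPS.const (c : ℂ)).isBounded.mul k4), fun n ↦ ?_⟩
    · rw [e]
      exact h2.cast_sub (k2.cast_const_mul c)
    · rw [e, ← sub_add, map_add, PowerSeries.coeff_C_mul]
      exact dvd_add (h4 n) (hc.mul_right _)

/-- The expansion of `q ^ M f_{k,M}`. -/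
def basisSeries (a : ℤ → ℤ → ℤ) (M : ℕ) : PowerSeries ℤ :=
  PowerSeries.mk fun n ↦ (if n = 0 then 1 else 0) + a M (n - M)

lemma IsBasisElt.hasPS {k : ℤ} {a : ℤ → ℤ → ℤ} (h0 : ∀ m n : ℤ, m < 0 ∨ n ≤ 0 → a m n = 0)
    {M : ℕ} {f : WhmForm ⊤ k} (hf : IsBasisElt k 0 M f)
    (hc : ∀ n : ℤ, 0 < n → f.coeff n = (a M n : ℂ)) :
    HasPS (qexp ^ M * f.toFun) (castPS (basisSeries a M)) := by
  convert f.expansion.hasPS M fun n hn ↦ hf.2 n (by omega) (by omega) using 1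
  ext n
  rw [coeff_castPS, basisSeries, PowerSeries.coeff_mk, PowerSeries.coeff_mk]
  rcases Nat.eq_zero_or_pos n with rfl | hn
  · rw [if_pos rfl, h0 _ _ (.inr (by omega)), Nat.cast_zero, zero_sub, hf.1]
    simp
  · rw [if_neg hn.ne', zero_add]
    rcases le_or_gt ((n : ℤ) - M) 0 with h | h
    · rw [h0 _ _ (.inr h), hf.2 _ (by omega) h, Int.cast_zero]
    · rw [hc _ h]

/-- The expansion of `f_{k,pm}(τ) - f_{k,m}(pτ)`. -/
def diffSeries (a : ℤ → ℤ → ℤ) (p m : ℕ) : PowerSeries ℤ :=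
  PowerSeries.mk fun n ↦ a (p * m : ℕ) n - if p ∣ n then a m (n / p : ℕ) else 0

lemma X_pow_mul_diffSeries {a : ℤ → ℤ → ℤ} (h0 : ∀ m n : ℤ, m < 0 ∨ n ≤ 0 → a m n = 0) (m : ℕ) :
    .X ^ (p * m) * diffSeries a p m = basisSeries a (p * m) - exq p (basisSeries a m) := by
  have hp := hpf.out.pos
  ext n
  rw [PowerSeries.coeff_X_pow_mul', map_sub, basisSeries, PowerSeries.coeff_mk]
  by_cases hn : p ∣ n
  · obtain ⟨n, rfl⟩ := hn
    rw [PowerSeries.coeff_expand_mul, basisSeries, PowerSeries.coeff_mk]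
    simp only [Nat.mul_eq_zero, hp.ne', false_or, add_sub_add_left_eq_sub]
    split_ifs with h
    · obtain ⟨l, rfl⟩ := Nat.exists_eq_add_of_le (Nat.le_of_mul_le_mul_left h hp)
      rw [diffSeries, PowerSeries.coeff_mk, ← Nat.mul_sub, Nat.add_sub_cancel_left,
        if_pos (dvd_mul_right _ _), Nat.mul_div_cancel_left _ hp]
      congr 2 <;> push_cast <;> ring
    · have h1 : n < m := by
        by_contra! h2
        exact h (Nat.mul_le_mul_left p h2)
      rw [h0 _ _ (.inr (by omega)), h0 _ _ (.inr (by omega)), sub_zero]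
  · have hn0 : n ≠ 0 := by
      rintro rfl
      exact hn (dvd_zero p)
    rw [PowerSeries.coeff_expand_of_not_dvd _ _ _ hn, sub_zero, if_neg hn0, zero_add]
    split_ifs with h
    · obtain ⟨l, rfl⟩ := Nat.exists_eq_add_of_le h
      rw [diffSeries, PowerSeries.coeff_mk, Nat.add_sub_cancel_left,
        if_neg fun h' ↦ hn ((Nat.dvd_add_right (dvd_mul_right p m)).mpr h'), sub_zero]
      congr 1
      push_cast
      ring
    · rw [h0 _ _ (.inr (by omega))]

lemma dvd_coeff_diffSeries (hE : ∀ r < D, HasEchelon p k r)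
    (hD : (p + 1) * k < 12 * D ∨ (p = 5 ∧ k % 4 = 2 ∧ (p + 1) * k = 12 * D))
    {l e : ℕ} {φ φW E : ℍ → ℂ} (hφ : IsHauptmodul p l φ φW) (hE' : IsUnitForm p k E) (hel : e ≤ l)
    {a : ℤ → ℤ → ℤ} (ha : IsCoeffs k a) (m : ℕ)
    (h : ∀ r < D, (p : ℤ) ^ e ∣ (diffSeries a p m).coeff r) (n : ℕ) :
    (p : ℤ) ^ e ∣ (diffSeries a p m).coeff n := by
  obtain ⟨f, hf, hfc⟩ := ha.1 (p * m : ℕ) (by positivity)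
  obtain ⟨g, hg, hgc⟩ := ha.1 m (by positivity)
  have hfP := hf.hasPS ha.2 hfc
  have hgP := hg.hasPS ha.2 hgc
  have hF : HasPS (f.toFun - fun τ ↦ g.toFun (dil p τ)) (castPS (diffSeries a p m)) := by
    refine .of_X_pow_mul (p * m) ?_
    rw [← castPS_X, ← map_pow castPS, ← map_mul, X_pow_mul_diffSeries ha.2]
    refine (hfP.cast_sub (hgP.dil p)).congr fun τ ↦ ?_
    simp only [Pi.mul_apply, Pi.sub_apply, Pi.pow_apply]
    rw [qexp_dil, ← pow_mul]
    ring
  have hG : HasPS (qexp ^ (p * (p * m)) *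
      ((fun τ ↦ (p : ℂ) ^ k * f.toFun (dil p τ)) - g.toFun))
      (castPS (PowerSeries.C ((p : ℤ) ^ k) * exq p (basisSeries a (p * m)) -
        .X ^ (p * (p * m) - m) * basisSeries a m)) := by
    have hX : HasPS qexp (castPS .X) := by rw [castPS_X]; exact .qexp
    refine (((hfP.dil p).cast_const_mul ((p : ℤ) ^ k)).cast_sub
      ((hX.cast_pow (p * (p * m) - m)).cast_mul hgP)).congr fun τ ↦ ?_
    have hle : m ≤ p * (p * m) := by
      have hp := hpf.out.pos
      exact (Nat.le_mul_of_pos_left m hp).trans (Nat.le_mul_of_pos_left _ hp)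
    simp only [Pi.mul_apply, Pi.sub_apply, Pi.pow_apply]
    rw [qexp_dil, ← pow_mul, ← mul_assoc (qexp τ ^ (p * (p * m) - m)), ← pow_add,
      Nat.sub_add_cancel hle]
    push_cast
    ring
  obtain ⟨F', G', P', h1, h2, h3, h4⟩ := PairForm.exists_bounded hφ hE' hel _
    ((pairForm_levelOne f.slash_top f.holo).sub (pairForm_levelOne_dil g.slash_top g.holo)) hF hG
  have h5 := h1.dvd_coeff hE hD h2 h3 (N := (p : ℤ) ^ e) (fun r hr ↦ by
    have := dvd_add (h4 r) (h r hr)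
    rwa [map_sub, sub_add_cancel] at this) n
  have := dvd_sub h5 (h4 n)
  rwa [map_sub, sub_sub_cancel] at this

end

end

/-- If `f_{2-k,j}|U_p` (resp. `f_{2-k,j}|U_p - f_{2-k,j/p}`) is congruent to its
constant term mod `p^ε` for `1 ≤ j ≤ d-1` with `p ∤ j` (resp. `p ∣ j`), then
`p^ε ∣ a_k(mpˢ,n)` for all `s > 0` and `m, n > 0` coprime to `p`.  Here
`A j n` is the coefficient `a_{2-k}(j,n)` of `f_{2-k,j} = q^{-j} + ∑_{n≥0} A j n qⁿ`. -/
theorem stmt_18 (p : ℕ) (hp : p ∈ ({2, 3, 5} : Set ℕ)) (k : ℕ)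
    (hk : k ∈ ({4, 6, 8, 10, 14} : Set ℕ))
    (d : ℕ) (hd : d = Module.finrank ℂ (ModularForm (Gamma0 p) (k : ℤ)))
    (a : ℤ → ℤ → ℤ) (ha : IsCoeffs k a)
    (g : ℤ → WhmForm ⊤ (2 - (k : ℤ))) (A : ℤ → ℤ → ℤ)
    (hg : ∀ j : ℤ, 1 ≤ j → IsBasisElt (2 - (k : ℤ)) (-1) j (g j))
    (hA : ∀ j n : ℤ, 1 ≤ j → 0 ≤ n → (g j).coeff n = (A j n : ℂ))
    (h1 : ∀ j : ℕ, 1 ≤ j → j ≤ d - 1 → ¬ p ∣ j →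
      ∀ n : ℤ, 1 ≤ n → (p : ℤ) ^ eps k p ∣ A j (p * n))
    (h2 : ∀ j : ℕ, 1 ≤ j → j ≤ d - 1 → p ∣ j →
      ∀ n : ℤ, 1 ≤ n → (p : ℤ) ^ eps k p ∣ (A j (p * n) - A ((j : ℤ) / p) n)) :
    ∀ s : ℕ, 0 < s → ∀ m n : ℤ, 0 < m → 0 < n → ¬ (p : ℤ) ∣ m → ¬ (p : ℤ) ∣ n →
      (p : ℤ) ^ eps k p ∣ a (m * p ^ s) n := by
  simp only [Set.mem_insert_iff, Set.mem_singleton_iff] at hp hk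
  have hp' : p.Prime := by rcases hp with rfl | rfl | rfl <;> norm_num
  have : Fact p.Prime := ⟨hp'⟩
  obtain ⟨D, hE, hD⟩ := exists_forall_hasEchelon hp hk
  obtain ⟨l, φ, φW, hφ, hel⟩ := exists_isHauptmodul hp k
  obtain ⟨E, hE'⟩ := exists_isUnitForm (p := p) hk
  have hDd : D ≤ d := hd ▸ le_finrank hE hD
  have hdual : ∀ M j : ℕ, 0 < M → 0 < j → a M j = -A j M := by
    intro M j hM hj
    obtain ⟨f, hf, hfc⟩ := ha.1 M (by positivity)
    have h := WhmForm.coeff_duality hM hj hf (hg j (by exact_mod_cast hj))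
    rw [hfc j (by exact_mod_cast hj), hA j M (by exact_mod_cast hj) (by positivity)] at h
    exact_mod_cast h
  have key : ∀ m : ℕ, 0 < m → ∀ n : ℕ, ¬ p ∣ n → (p : ℤ) ^ eps k p ∣ a (p * m : ℕ) n := by
    intro m hm n hn
    have hpm : 0 < p * m := Nat.mul_pos hp'.pos hm
    have h := dvd_coeff_diffSeries hE hD hφ hE' hel ha m (fun r hr ↦ ?_) n
    · rwa [diffSeries, PowerSeries.coeff_mk, if_neg hn, sub_zero] at h
    rw [diffSeries, PowerSeries.coeff_mk]
    rcases Nat.eq_zero_or_pos r with rfl | hr0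
    · rw [ha.2 _ _ (.inr (by simp)), if_pos (dvd_zero p), ha.2 _ _ (.inr (by simp)), sub_zero]
      exact dvd_zero _
    rw [hdual _ _ hpm hr0, Nat.cast_mul]
    split_ifs with hpr
    · rw [hdual _ _ hm (Nat.div_pos (Nat.le_of_dvd hr0 hpr) hp'.pos), Int.natCast_div]
      have := h2 r hr0 (by omega) hpr m (by exact_mod_cast hm)
      rw [← neg_sub', dvd_neg]
      exact this
    · rw [sub_zero, dvd_neg]
      exact h1 r hr0 (by omega) hpr m (by exact_mod_cast hm)
  intro s hs m n hm hn _ hpn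
  lift m to ℕ using hm.le
  lift n to ℕ using hn.le
  obtain ⟨s, rfl⟩ := Nat.exists_eq_succ_of_ne_zero hs.ne'
  have h := key (m * p ^ s) (Nat.mul_pos (by exact_mod_cast hm) (pow_pos hp'.pos s)) n
    (by exact_mod_cast hpn)
  convert h using 2
  push_cast [pow_succ]
  ring
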